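/- Let 0 < a < 1. For every badly approximable real number α, the set of real numbers β such that liminf_{q→∞} q·(log q)^{2−a}·(log(1/‖qα‖))^a·‖qα‖·‖qβ‖ > 0 has full Hausdorff dimension. -/

import Mathlib

open Filter
noncomputable def nint (y : ℝ) : ℝ := |y - round y|

lemma card_int_le (u v : ℝ) (huv : u ≤ v) (S : Finset ℤ)
    (h : ∀ i ∈ S, u ≤ (i:ℝ) ∧ (i:ℝ) ≤ v) : (S.card : ℝ) ≤ v - u + 1 := by
  have h1 : S ⊆ Finset.Icc ⌈u⌉ ⌊v⌋ := by
    intro i hi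
    rw [Finset.mem_Icc]
    exact ⟨Int.ceil_le.2 (h i hi).1, Int.le_floor.2 (h i hi).2⟩
  have h2 := Finset.card_le_card h1
  rw [Int.card_Icc] at h2
  have h3 : (S.card : ℝ) ≤ ((⌊v⌋ + 1 - ⌈u⌉).toNat : ℝ) := by exact_mod_cast h2
  have h4 : ((⌊v⌋ + 1 - ⌈u⌉).toNat : ℝ) = ((max (⌊v⌋ + 1 - ⌈u⌉) 0 : ℤ) : ℝ) := by
    rw [← Int.toNat_eq_max]; norm_cast
  rw [h4] at h3
  push_cast at h3
  have := Int.floor_le v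
  have := Int.le_ceil u
  have h5 : max ((⌊v⌋:ℝ) + 1 - ⌈u⌉) 0 ≤ v - u + 1 := by
    apply max_le <;> linarith
  linarith

lemma card_int_ge (u v : ℝ) (S : Finset ℤ)
    (h : ∀ i : ℤ, u ≤ (i:ℝ) → (i:ℝ) ≤ v → i ∈ S) : v - u - 1 ≤ (S.card : ℝ) := by
  have h1 : Finset.Icc ⌈u⌉ ⌊v⌋ ⊆ S := by
    intro i hi
    rw [Finset.mem_Icc] at hi
    exact h i (Int.ceil_le.1 hi.1) (Int.le_floor.1 hi.2)
  have h2 := Finset.card_le_card h1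
  rw [Int.card_Icc] at h2
  have h3 : ((⌊v⌋ + 1 - ⌈u⌉ : ℤ) : ℝ) ≤ (S.card : ℝ) := by
    have : (⌊v⌋ + 1 - ⌈u⌉) ≤ (S.card : ℤ) := by omega
    exact_mod_cast this
  push_cast at h3
  have := Int.lt_floor_add_one v
  have := Int.ceil_lt_add_one u
  linarith

lemma nint_le (y : ℝ) (n : ℤ) : nint y ≤ |y - n| := round_le y n

lemma nint_le_half (y : ℝ) : nint y ≤ 1 / 2 := abs_sub_round y

lemma nint_nonneg (y : ℝ) : 0 ≤ nint y := abs_nonneg _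

lemma bad_int (α c : ℝ) (hα : ∀ q : ℕ, 1 ≤ q → c ≤ (q : ℝ) * nint (q * α)) (e l : ℤ) (he : e ≠ 0) :
    c ≤ |(e:ℝ)| * |e * α - l| := by
  have h1 : 1 ≤ e.natAbs := by omega
  have h2 := hα e.natAbs h1
  have h3 : ((e.natAbs : ℕ) : ℝ) = |(e:ℝ)| := by
    rw [Nat.cast_natAbs]; push_cast; rfl
  rw [h3] at h2
  refine h2.trans (mul_le_mul_of_nonneg_left ?_ (abs_nonneg _))
  rcases abs_choice (e:ℝ) with h | h
  · rw [h]; exact nint_le _ _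
  · rw [h]
    refine (nint_le _ (-l)).trans (le_of_eq ?_)
    rw [← abs_neg]; congr 1; push_cast; ring

lemma count_Y (α c : ℝ) (hc : 0 < c)
    (hα : ∀ q : ℕ, 1 ≤ q → c ≤ (q : ℝ) * nint (q * α)) (Q X : ℝ) (S : Finset ℕ)
    (hS : ∀ q ∈ S, 1 ≤ q ∧ (q:ℝ) ≤ Q ∧ nint (q * α) ≤ X) (hQ : 0 ≤ Q) (hX : 0 ≤ X) :
    (S.card : ℝ) ≤ 4 / c * (Q * X) := by
  rcases S.eq_empty_or_nonempty with rfl | ⟨q0, hq0⟩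
  · simp; positivity
  have hQX : c ≤ Q * X := by
    obtain ⟨h1, h2, h3⟩ := hS q0 hq0
    exact (hα q0 h1).trans (mul_le_mul h2 h3 (nint_nonneg _) hQ)
  have hQ0 : 0 < Q := by
    rcases hQ.lt_or_eq with h | h
    · exact h
    · rw [← h] at hQX; linarith
  let f : ℕ → ℤ := fun q => ⌊((q:ℝ) * α - round ((q:ℝ) * α)) * (Q / c)⌋
  have hinj : Set.InjOn f S := by
    intro q hq q' hq' hff
    by_contra hne
    have h1 := Int.abs_sub_lt_one_of_floor_eq_floor hff
    have h2 := bad_int α c hα ((q:ℤ) - q') (round ((q:ℝ) * α) - round ((q':ℝ) * α)) (by omega)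
    rw [← sub_mul, abs_mul, abs_of_pos (by positivity : 0 < Q / c)] at h1
    push_cast at h2
    have h3 : |(q:ℝ) - q'| ≤ Q := by
      obtain ⟨_, h2, _⟩ := hS q hq
      obtain ⟨_, h2', _⟩ := hS q' hq'
      rw [abs_le]; constructor <;> linarith [(Nat.cast_nonneg q : (0:ℝ) ≤ q), (Nat.cast_nonneg q' : (0:ℝ) ≤ q')]
    have h4 : |((q:ℝ) - q') * α - (round ((q:ℝ) * α) - round ((q':ℝ) * α))| =
      |(q:ℝ) * α - round ((q:ℝ) * α) - ((q':ℝ) * α - round ((q':ℝ) * α))| := by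
      congr 1; ring
    rw [h4] at h2
    have h5 := h2.trans (mul_le_mul_of_nonneg_right h3 (abs_nonneg _))
    rw [mul_div_assoc', div_lt_one hc] at h1
    linarith
  have hcard := Finset.card_image_of_injOn hinj
  have h6 := card_int_le (-(X * (Q / c)) - 1) (X * (Q / c)) (by
    have : 0 ≤ X * (Q / c) := by positivity
    linarith) (S.image f) (by
      intro i hi
      obtain ⟨q, hq, rfl⟩ := Finset.mem_image.1 hi
      obtain ⟨_, _, h3⟩ := hS q hq
      have h4 := abs_le.1 h3
      have h7 := Int.floor_le (((q:ℝ) * α - round ((q:ℝ) * α)) * (Q / c))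
      have h8 := Int.lt_floor_add_one (((q:ℝ) * α - round ((q:ℝ) * α)) * (Q / c))
      have h9 : ((q:ℝ) * α - round ((q:ℝ) * α)) * (Q / c) ≤ X * (Q / c) :=
        mul_le_mul_of_nonneg_right h4.2 (by positivity)
      have h10 : -X * (Q / c) ≤ ((q:ℝ) * α - round ((q:ℝ) * α)) * (Q / c) :=
        mul_le_mul_of_nonneg_right h4.1 (by positivity)
      constructor
      · show _ ≤ ((⌊_⌋ : ℤ) : ℝ)
        linarith
      · exact h7.trans h9)
  rw [hcard] at h6
  have h7 : 1 ≤ Q * X / c := by rw [le_div_iff₀ hc]; linarith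
  have h8 : X * (Q / c) = Q * X / c := by ring
  have h9 : 4 / c * (Q * X) = 4 * (Q * X / c) := by ring
  rw [h8] at h6
  rw [h9]
  linarith

lemma sum_rpow_le (a : ℝ) (ha : 0 < a) (ha1 : a < 1) (J : ℕ) :
    ∑ j ∈ Finset.Icc 1 J, (j:ℝ) ^ (-a) ≤ (J:ℝ) ^ (1 - a) / (1 - a) := by
  have h1a : 0 < 1 - a := by linarith
  induction J with
  | zero => simp; positivity
  | succ J ih =>
    rw [Finset.sum_Icc_succ_top (by omega)]
    have hJ : (0:ℝ) < ((J+1 : ℕ):ℝ) := by positivity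
    set x : ℝ := ((J+1 : ℕ):ℝ) with hx
    have hJx : (J:ℝ) = x * (1 + (-(1/x))) := by
      rw [hx]; push_cast
      have : (J:ℝ) + 1 ≠ 0 := by positivity
      field_simp; ring
    have hx1 : 1 ≤ x := by rw [hx]; push_cast; linarith [(Nat.cast_nonneg J : (0:ℝ) ≤ J)]
    have hxinv : 1 / x ≤ 1 := by rw [div_le_one hJ]; exact hx1
    have hb := rpow_one_add_le_one_add_mul_self (s := -(1/x)) (by linarith) (p := 1 - a) h1a.le (by linarith)
    have h2 : (J:ℝ) ^ (1 - a) ≤ x ^ (1 - a) - (1 - a) * x ^ (-a) := by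
      rw [hJx, Real.mul_rpow hJ.le (by linarith)]
      have h3 : x ^ (-a) = x ^ (1 - a) * (1 / x) := by
        rw [show -a = (1 - a) - 1 by ring, Real.rpow_sub_one hJ.ne']; ring
      rw [h3]
      have := mul_le_mul_of_nonneg_left hb (Real.rpow_nonneg hJ.le (1 - a))
      calc _ ≤ _ := this
        _ = _ := by ring
    calc _ ≤ (J:ℝ) ^ (1 - a) / (1 - a) + x ^ (-a) := by gcongr
      _ ≤ (x ^ (1 - a) - (1 - a) * x ^ (-a)) / (1 - a) + x ^ (-a) := by gcongr
      _ = _ := by field_simp; ring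

lemma sum_upper (a : ℝ) (ha : 0 < a) (ha1 : a < 1) (α c : ℝ) (hc : 0 < c)
    (hα : ∀ q : ℕ, 1 ≤ q → c ≤ (q : ℝ) * nint (q * α)) :
    ∃ K > 0, ∀ m : ℕ, 1 ≤ m → ∑ q ∈ Finset.Ico ((2:ℕ)^m) ((2:ℕ)^(10*m)),
      1 / ((q:ℝ) * (Real.log q) ^ (2 - a) * (Real.log (1 / nint (q * α))) ^ a * nint (q * α)) ≤ K := by
  have h1a : 0 < 1 - a := by linarith
  obtain ⟨k, hk⟩ := pow_unbounded_of_one_lt (1 / c) (one_lt_two : (1:ℝ) < 2)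
  set l := Real.log 2 with hl
  have hl0 : 0 < l := Real.log_pos one_lt_two
  refine ⟨(16 / c) * l⁻¹ ^ 2 * 9 * (((10 + k : ℕ):ℝ) ^ (1 - a) / (1 - a)), by positivity, ?_⟩
  intro m hm
  have hm0 : (0:ℝ) < m := by exact_mod_cast hm
  set φ : ℕ → ℕ × ℕ := fun q => (Nat.log 2 q, Nat.log 2 ⌊1 / nint (q * α)⌋₊) with hφ
  set J : ℕ := (10 + k) * m with hJ
  have hfacts : ∀ q ∈ Finset.Ico ((2:ℕ)^m) ((2:ℕ)^(10*m)), 0 < nint (q * α) ∧ 1 ≤ q ∧ m ≤ (φ q).1 ∧ (φ q).1 < 10 * m ∧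
      1 ≤ (φ q).2 ∧ (φ q).2 ≤ J ∧ (2:ℝ) ^ (φ q).1 ≤ q ∧ (q:ℝ) ≤ 2 ^ ((φ q).1 + 1) ∧
      (2:ℝ) ^ (φ q).2 ≤ 1 / nint (q * α) ∧ 1 / nint (q * α) ≤ 2 ^ ((φ q).2 + 1) := by
    intro q hq
    rw [Finset.mem_Ico] at hq
    have hq1 : 1 ≤ q := le_trans Nat.one_le_two_pow hq.1
    have hqr : (1:ℝ) ≤ q := by exact_mod_cast hq1
    have hY := hα q hq1
    have hYp : 0 < nint (q * α) := by
      rcases (nint_nonneg (q * α)).lt_or_eq with h | h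
      · exact h
      · rw [← h] at hY; linarith
    have h2 : (2:ℝ) ≤ 1 / nint (q * α) := by
      rw [le_div_iff₀ hYp]; linarith [nint_le_half (q * α)]
    have h2' : 2 ≤ ⌊1 / nint (q * α)⌋₊ := Nat.le_floor (by exact_mod_cast h2)
    have e1 : (2:ℝ) ^ (φ q).2 ≤ 1 / nint (q * α) := by
      have h3 : 2 ^ (φ q).2 ≤ ⌊1 / nint (q * α)⌋₊ := Nat.pow_log_le_self 2 (by omega)
      have h4 : ((2 ^ (φ q).2 : ℕ) : ℝ) ≤ (⌊1 / nint (q * α)⌋₊ : ℝ) := by exact_mod_cast h3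
      push_cast at h4
      exact h4.trans (Nat.floor_le (by positivity))
    refine ⟨hYp, hq1, ?_, ?_, ?_, ?_, ?_, ?_, e1, ?_⟩
    · exact Nat.le_log_of_pow_le (by norm_num) hq.1
    · exact Nat.log_lt_of_lt_pow (by omega) hq.2
    · show 1 ≤ Nat.log 2 ⌊1 / nint (q * α)⌋₊
      exact Nat.le_log_of_pow_le (b := 2) (by norm_num) (by rw [pow_one]; exact h2')
    · have h5 : 1 / nint (q * α) ≤ 2 ^ (10 * m) * 2 ^ k := by
        have : 1 / nint (q * α) ≤ q * (1 / c) := by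
          rw [div_le_iff₀ hYp]
          have : q * (1 / c) * nint (q * α) = q * nint (q * α) / c := by ring
          rw [this, le_div_iff₀ hc]; linarith
        refine this.trans ?_
        have hq2 : (q:ℝ) ≤ 2 ^ (10 * m) := by exact_mod_cast hq.2.le
        gcongr
      have h6 : (2:ℝ) ^ (φ q).2 ≤ 2 ^ J := by
        refine e1.trans (h5.trans ?_)
        rw [← pow_add]
        apply pow_le_pow_right₀ one_le_two
        rw [hJ]; nlinarith
      exact (pow_le_pow_iff_right₀ one_lt_two).1 h6
    · have := Nat.pow_log_le_self 2 (x := q) (by omega)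
      exact_mod_cast this
    · have := (Nat.lt_pow_succ_log_self (b := 2) (by norm_num) q).le
      exact_mod_cast this
    · have h3 := Nat.lt_pow_succ_log_self (b := 2) (by norm_num) ⌊1 / nint (q * α)⌋₊
      have h4 := (Nat.floor_lt (by positivity)).1 h3
      push_cast at h4
      exact h4.le
  have hmaps : ∀ q ∈ Finset.Ico ((2:ℕ)^m) ((2:ℕ)^(10*m)), φ q ∈ (Finset.Ico m (10*m)) ×ˢ (Finset.Icc 1 J) := by
    intro q hq
    obtain ⟨_, _, h1, h2, h3, h4, _⟩ := hfacts q hq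
    rw [Finset.mem_product, Finset.mem_Ico, Finset.mem_Icc]
    exact ⟨⟨h1, h2⟩, h3, h4⟩
  rw [← Finset.sum_fiberwise_of_maps_to hmaps]
  have hfib : ∀ p ∈ (Finset.Ico m (10*m)) ×ˢ (Finset.Icc 1 J),
      ∑ q ∈ (Finset.Ico ((2:ℕ)^m) ((2:ℕ)^(10*m))).filter (fun q => φ q = p),
      1 / ((q:ℝ) * (Real.log q) ^ (2 - a) * (Real.log (1 / nint (q * α))) ^ a * nint (q * α))
      ≤ (16 / c) * l⁻¹ ^ 2 * (m:ℝ) ^ (-(2 - a)) * (p.2:ℝ) ^ (-a) := by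
    rintro ⟨n, j⟩ hp
    rw [Finset.mem_product, Finset.mem_Ico, Finset.mem_Icc] at hp
    obtain ⟨⟨hp1, hp2⟩, hp3, hp4⟩ := hp
    simp only at hp1 hp2 hp3 hp4 ⊢
    have hj0 : (0:ℝ) < j := by exact_mod_cast hp3
    set S := (Finset.Ico ((2:ℕ)^m) ((2:ℕ)^(10*m))).filter (fun q => φ q = (n, j)) with hS
    have hcard : (S.card : ℝ) ≤ 4 / c * (2 ^ (n+1) * (1 / 2 ^ j)) := by
      apply count_Y α c hc hα _ _ _ _ (by positivity) (by positivity)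
      intro q hq
      rw [hS, Finset.mem_filter] at hq
      obtain ⟨h0, h1, h2, h3, h4, h5, h6, h7, h8, h9⟩ := hfacts q hq.1
      rw [hq.2] at h7 h8
      refine ⟨h1, h7, ?_⟩
      rw [le_div_iff₀ (by positivity), mul_comm]
      rwa [le_div_iff₀ h0] at h8
    have hterm : ∀ q ∈ S, 1 / ((q:ℝ) * (Real.log q) ^ (2 - a) * (Real.log (1 / nint (q * α))) ^ a * nint (q * α))
        ≤ 1 / 2 ^ n * ((m * l) ^ (-(2-a)) * (j * l) ^ (-a)) * 2 ^ (j+1) := by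
      intro q hq
      rw [hS, Finset.mem_filter] at hq
      obtain ⟨h0, h1, h2, h3, h4, h5, h6, h7, h8, h9⟩ := hfacts q hq.1
      rw [hq.2] at h2 h6 h7 h8 h9
      simp only at h2 h6 h7 h8 h9
      have hL : m * l ≤ Real.log q := by
        rw [hl, ← Real.log_pow]
        apply Real.log_le_log (by positivity)
        exact le_trans (pow_le_pow_right₀ one_le_two h2) h6
      have hL2 : j * l ≤ Real.log (1 / nint (q * α)) := by
        rw [hl, ← Real.log_pow]
        exact Real.log_le_log (by positivity) h8
      have e1 : 1 / (q:ℝ) ≤ 1 / 2 ^ n := by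
        apply one_div_le_one_div_of_le (by positivity) h6
      have e2 : 1 / (Real.log q) ^ (2 - a) ≤ (m * l) ^ (-(2-a)) := by
        rw [Real.rpow_neg (by positivity), ← one_div]
        apply one_div_le_one_div_of_le (by positivity)
        exact Real.rpow_le_rpow (by positivity) hL (by linarith)
      have e3 : 1 / (Real.log (1 / nint (q * α))) ^ a ≤ (j * l) ^ (-a) := by
        rw [Real.rpow_neg (by positivity), ← one_div]
        apply one_div_le_one_div_of_le (by positivity)
        exact Real.rpow_le_rpow (by positivity) hL2 (by linarith)
      have hml : 0 < m * l := by positivity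
      have hjl : 0 < j * l := by positivity
      have p2 : 0 ≤ 1 / (Real.log q) ^ (2 - a) := by
        have := Real.rpow_nonneg (hml.le.trans hL) (2 - a)
        positivity
      have p3 : 0 ≤ 1 / (Real.log (1 / nint (q * α))) ^ a := by
        have := Real.rpow_nonneg (hjl.le.trans hL2) a
        positivity
      calc _ = 1 / (q:ℝ) * (1 / (Real.log q) ^ (2 - a) * (1 / (Real.log (1 / nint (q * α))) ^ a)) * (1 / nint (q * α)) := by
            rw [one_div_mul_one_div, one_div_mul_one_div, one_div_mul_one_div]; congr 1; ring
        _ ≤ _ := by gcongr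
    have hsum := Finset.sum_le_card_nsmul S _ _ hterm
    refine hsum.trans ?_
    rw [nsmul_eq_mul]
    have hA : (0:ℝ) ≤ 1 / 2 ^ n * ((m * l) ^ (-(2-a)) * (j * l) ^ (-a)) * 2 ^ (j+1) := by positivity
    refine (mul_le_mul_of_nonneg_right hcard hA).trans (le_of_eq ?_)
    rw [Real.mul_rpow hm0.le hl0.le, Real.mul_rpow hj0.le hl0.le]
    have e4 : l ^ (-(2-a)) * l ^ (-a) = l⁻¹ ^ 2 := by
      rw [← Real.rpow_add hl0, show -(2-a) + -a = -(2:ℝ) by ring, Real.rpow_neg hl0.le, Real.rpow_two, inv_pow]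
    rw [← e4]
    field_simp
    ring
  refine (Finset.sum_le_sum hfib).trans ?_
  rw [Finset.sum_product]
  simp only [← Finset.mul_sum, Finset.sum_const, nsmul_eq_mul, Nat.card_Ico]
  have h9 : ((10 * m - m : ℕ) : ℝ) = 9 * m := by
    have : 10 * m - m = 9 * m := by omega
    rw [this]; push_cast; rfl
  rw [h9]
  have hs := sum_rpow_le a ha ha1 J
  have hJ' : (J:ℝ) ^ (1 - a) = ((10 + k : ℕ):ℝ) ^ (1 - a) * (m:ℝ) ^ (1 - a) := by
    rw [hJ, Nat.cast_mul, Real.mul_rpow (by positivity) hm0.le]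
  rw [hJ'] at hs
  have e5 : (m:ℝ) ^ (-(2 - a)) * m * (m:ℝ) ^ (1 - a) = 1 := by
    nth_rewrite 2 [← Real.rpow_one (m:ℝ)]
    rw [← Real.rpow_add hm0, ← Real.rpow_add hm0]
    rw [show -(2 - a) + 1 + (1 - a) = 0 by ring, Real.rpow_zero]
  calc _ ≤ 9 * (m:ℝ) * (16 / c * l⁻¹ ^ 2 * (m:ℝ) ^ (-(2 - a)) *
        (((10 + k : ℕ):ℝ) ^ (1 - a) * (m:ℝ) ^ (1 - a) / (1 - a))) := by
          have := mul_le_mul_of_nonneg_left hs (show 0 ≤ 9 * (m:ℝ) * (16 / c * l⁻¹ ^ 2 * (m:ℝ) ^ (-(2 - a))) by positivity)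
          refine le_trans (le_of_eq ?_) (this.trans (le_of_eq ?_))
          · ring
          · ring
    _ = (16 / c) * l⁻¹ ^ 2 * 9 * (((10 + k : ℕ):ℝ) ^ (1 - a) / (1 - a)) * ((m:ℝ) ^ (-(2 - a)) * m * (m:ℝ) ^ (1 - a)) := by ring
    _ ≤ _ := by rw [e5, mul_one]

lemma pigeon (α : ℝ) (n j : ℕ) (hjn : j ≤ n) :
    2 ^ (n - j) ≤ ((Finset.Icc 1 (2 ^ n)).filter (fun q : ℕ => nint (q * α) ≤ 1 / 2 ^ j)).card := by
  let f : ℕ → ℕ := fun q => ⌊Int.fract ((q:ℝ) * α) * 2 ^ j⌋₊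
  have hmaps : ∀ q ∈ Finset.range (2 ^ n + 1), f q ∈ Finset.range (2 ^ j) := by
    intro q _
    rw [Finset.mem_range]
    rw [Nat.floor_lt (mul_nonneg (Int.fract_nonneg _) (by positivity))]
    push_cast
    have := Int.fract_lt_one ((q:ℝ) * α)
    have h2 : (0:ℝ) < 2 ^ j := by positivity
    nlinarith
  have hlt : (Finset.range (2 ^ j)).card * 2 ^ (n - j) < (Finset.range (2 ^ n + 1)).card := by
    rw [Finset.card_range, Finset.card_range, ← pow_add, Nat.add_sub_cancel' hjn]; omega
  obtain ⟨b, _, hb⟩ := Finset.exists_lt_card_fiber_of_mul_lt_card_of_maps_to hmaps hlt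
  set F := (Finset.range (2 ^ n + 1)).filter (fun q => f q = b) with hF
  have hne : F.Nonempty := Finset.card_pos.1 (lt_of_le_of_lt (Nat.zero_le _) hb)
  have hmem := F.min'_mem hne
  set m := F.min' hne with hm
  have hle : (F.erase m).card ≤
      ((Finset.Icc 1 (2 ^ n)).filter (fun q : ℕ => nint (q * α) ≤ 1 / 2 ^ j)).card := by
    apply Finset.card_le_card_of_injOn (fun q => q - m)
    · intro q hq
      rw [Finset.mem_coe, Finset.mem_erase] at hq
      obtain ⟨hqm, hqF⟩ := hq
      have hmq : m ≤ q := F.min'_le q hqF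
      have hq1 := hqF
      rw [hF, Finset.mem_filter, Finset.mem_range] at hq1 hmem
      simp only [Finset.coe_filter, Finset.mem_Icc, Set.mem_ofPred_eq]
      refine ⟨⟨by omega, by omega⟩, ?_⟩
      have e : f q = f m := by rw [hq1.2, hmem.2]
      have p1 : (0:ℝ) ≤ Int.fract ((q:ℝ) * α) * 2 ^ j := mul_nonneg (Int.fract_nonneg _) (by positivity)
      have p2 : (0:ℝ) ≤ Int.fract ((m:ℝ) * α) * 2 ^ j := mul_nonneg (Int.fract_nonneg _) (by positivity)
      have a1 := Nat.floor_le p1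
      have a2 := Nat.lt_floor_add_one (Int.fract ((q:ℝ) * α) * 2 ^ j)
      have a3 := Nat.floor_le p2
      have a4 := Nat.lt_floor_add_one (Int.fract ((m:ℝ) * α) * 2 ^ j)
      have e' : ((f q : ℕ):ℝ) = f m := by rw [e]
      change ((⌊Int.fract ((q:ℝ) * α) * 2 ^ j⌋₊ : ℕ) : ℝ) = ((⌊Int.fract ((m:ℝ) * α) * 2 ^ j⌋₊ : ℕ) : ℝ) at e'
      refine (nint_le _ (⌊(q:ℝ) * α⌋ - ⌊(m:ℝ) * α⌋)).trans ?_
      have e2 : ((q - m : ℕ):ℝ) * α - ((⌊(q:ℝ) * α⌋ - ⌊(m:ℝ) * α⌋ : ℤ):ℝ) =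
          Int.fract ((q:ℝ) * α) - Int.fract ((m:ℝ) * α) := by
        rw [Nat.cast_sub hmq, Int.fract, Int.fract]; push_cast; ring
      rw [e2, le_div_iff₀ (by positivity), ← abs_of_pos (by positivity : (0:ℝ) < 2 ^ j), ← abs_mul, sub_mul, abs_le]
      constructor <;> linarith
    · intro q hq q' hq' h
      rw [Finset.mem_coe, Finset.mem_erase] at hq hq'
      have h1 : m ≤ q := F.min'_le q hq.2
      have h2 : m ≤ q' := F.min'_le q' hq'.2
      simp only at h
      omega
  rw [Finset.card_erase_of_mem hmem] at hle
  omega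

lemma geo1 (n : ℕ) : ∀ k : ℕ, ∑ u ∈ Finset.range n, (1:ℝ) / 2 ^ (k + u) ≤ 2 / 2 ^ k := by
  induction n with
  | zero => intro k; simp only [Finset.range_zero, Finset.sum_empty]; positivity
  | succ n ih =>
    intro k
    rw [Finset.sum_range_succ']
    have h := ih (k + 1)
    have e : ∀ u, (1:ℝ) / 2 ^ (k + (u + 1)) = 1 / 2 ^ (k + 1 + u) := fun u => by
      rw [show k + (u + 1) = k + 1 + u by ring]
    simp only [e]
    refine (add_le_add_left h _).trans (le_of_eq ?_)
    rw [pow_succ, add_zero]; field_simp; ring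

lemma geo2 (x : ℝ) (hx : 0 < x) (n : ℕ) : ∀ k : ℕ,
    ∑ u ∈ Finset.range n, (if x ≤ 2 ^ (k + u) then (1:ℝ) / 2 ^ (k + u) else 0) ≤ 2 / x := by
  induction n with
  | zero => intro k; simp; positivity
  | succ n ih =>
    intro k
    by_cases h : x ≤ 2 ^ k
    · calc _ ≤ ∑ u ∈ Finset.range (n+1), (1:ℝ) / 2 ^ (k + u) := by
            apply Finset.sum_le_sum
            intro u _
            split_ifs
            · exact le_refl _
            · positivity
        _ ≤ 2 / 2 ^ k := geo1 _ _
        _ ≤ 2 / x := by gcongr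
    · rw [Finset.sum_range_succ']
      have h' := ih (k + 1)
      rw [add_zero, if_neg h, add_zero]
      refine le_trans (le_of_eq ?_) h'
      apply Finset.sum_congr rfl
      intro u _
      rw [show k + (u + 1) = k + 1 + u by ring]

lemma geo3 (k n : ℕ) : ∑ v ∈ Finset.range (n+1), (2:ℝ) ^ (k + v) ≤ 2 * 2 ^ (k + n) := by
  induction n with
  | zero =>
    rw [zero_add, Finset.sum_range_one]
    linarith [pow_pos (two_pos : (0:ℝ) < 2) (k + 0)]
  | succ n ih =>
    rw [Finset.sum_range_succ]
    have : (2:ℝ) ^ (k + (n + 1)) = 2 * 2 ^ (k + n) := by rw [← add_assoc, pow_succ]; ring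
    rw [this]; linarith

lemma geo4 (y : ℝ) (hy : 0 < y) (k n : ℕ) :
    ∑ v ∈ Finset.range n, (if y ≤ 1 / 2 ^ (k + v) then (2:ℝ) ^ (k + v) else 0) ≤ 2 / y := by
  induction n with
  | zero => simp; positivity
  | succ n ih =>
    by_cases h : y ≤ 1 / 2 ^ (k + n)
    · calc _ ≤ ∑ v ∈ Finset.range (n+1), (2:ℝ) ^ (k + v) := by
            apply Finset.sum_le_sum
            intro u _
            split_ifs
            · exact le_refl _
            · positivity
        _ ≤ 2 * 2 ^ (k + n) := geo3 _ _
        _ ≤ 2 / y := by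
          rw [le_div_iff₀ hy]
          rw [le_div_iff₀ (by positivity)] at h
          linarith
    · rw [Finset.sum_range_succ, if_neg h, add_zero]
      exact ih

lemma sum_B (α c : ℝ) (hc : 0 < c)
    (hα : ∀ q : ℕ, 1 ≤ q → c ≤ (q : ℝ) * nint (q * α)) (M : ℕ) :
    (M:ℝ) ^ 2 / 8 ≤ ∑ q ∈ (Finset.Icc 1 (2 ^ (6 * M))).filter (fun q : ℕ => nint (q * α) ≤ 1 / 2 ^ (5 * M)),
      1 / ((q:ℝ) * nint (q * α)) := by
  set B := (Finset.Icc 1 (2 ^ (6 * M))).filter (fun q : ℕ => nint (q * α) ≤ 1 / 2 ^ (5 * M)) with hB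
  let f : ℕ → ℕ → ℝ := fun q u => if (q:ℝ) ≤ 2 ^ (5 * M + u) then (1:ℝ) / 2 ^ (5 * M + u) else 0
  let g : ℕ → ℕ → ℝ := fun q v => if nint (q * α) ≤ 1 / 2 ^ (5 * M + v) then (2:ℝ) ^ (5 * M + v) else 0
  have hf0 : ∀ q u, 0 ≤ f q u := by
    intro q u; simp only [f]; split_ifs <;> positivity
  have hg0 : ∀ q u, 0 ≤ g q u := by
    intro q u; simp only [g]; split_ifs <;> positivity
  have h1 : ∀ q ∈ B, (∑ u ∈ Finset.range (M+1), f q u) * (∑ v ∈ Finset.range (M+1), g q v) ≤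
      4 * (1 / ((q:ℝ) * nint (q * α))) := by
    intro q hq
    rw [hB, Finset.mem_filter, Finset.mem_Icc] at hq
    have hq0 : (0:ℝ) < q := by exact_mod_cast hq.1.1
    have hY := hα q hq.1.1
    have hYp : 0 < nint (q * α) := by
      rcases (nint_nonneg (q * α)).lt_or_eq with h | h
      · exact h
      · rw [← h] at hY; linarith
    calc _ ≤ (2 / (q:ℝ)) * (2 / nint (q * α)) := by
          apply mul_le_mul (geo2 _ hq0 _ _) (geo4 _ hYp _ _)
          · exact Finset.sum_nonneg (fun v _ => hg0 q v)
          · positivity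
      _ = _ := by field_simp; norm_num
  have h2 := Finset.sum_le_sum h1
  rw [← Finset.mul_sum] at h2
  have h3 : ∑ q ∈ B, (∑ u ∈ Finset.range (M+1), f q u) * (∑ v ∈ Finset.range (M+1), g q v) =
      ∑ u ∈ Finset.range (M+1), ∑ v ∈ Finset.range (M+1), ∑ q ∈ B, f q u * g q v := by
    simp only [Finset.sum_mul_sum]
    rw [Finset.sum_comm]
    apply Finset.sum_congr rfl
    intro u _
    rw [Finset.sum_comm]
  rw [h3] at h2
  have h4 : ∀ u ∈ Finset.range (M+1), (u:ℝ) + 1 ≤ ∑ v ∈ Finset.range (M+1), ∑ q ∈ B, f q u * g q v := by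
    intro u hu
    rw [Finset.mem_range] at hu
    have h5 : ∀ v ∈ Finset.range (u+1), (1:ℝ) ≤ ∑ q ∈ B, f q u * g q v := by
      intro v hv
      rw [Finset.mem_range] at hv
      have hp := pigeon α (5 * M + u) (5 * M + v) (by omega)
      set T := (Finset.Icc 1 (2 ^ (5 * M + u))).filter (fun q : ℕ => nint (q * α) ≤ 1 / 2 ^ (5 * M + v)) with hT
      have hTB : T ⊆ B := by
        intro q hq
        rw [hT, Finset.mem_filter, Finset.mem_Icc] at hq
        rw [hB, Finset.mem_filter, Finset.mem_Icc]
        refine ⟨⟨hq.1.1, hq.1.2.trans (Nat.pow_le_pow_right (by norm_num) (by omega))⟩, hq.2.trans ?_⟩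
        apply one_div_le_one_div_of_le (by positivity)
        exact pow_le_pow_right₀ one_le_two (by omega)
      calc (1:ℝ) ≤ (T.card : ℝ) * (1 / 2 ^ (5 * M + u) * 2 ^ (5 * M + v)) := by
            have hp' : (2:ℝ) ^ (5 * M + u - (5 * M + v)) ≤ T.card := by exact_mod_cast hp
            have e : (2:ℝ) ^ (5 * M + u) = 2 ^ (5 * M + u - (5 * M + v)) * 2 ^ (5 * M + v) := by
              rw [← pow_add]; congr 1; omega
            calc (1:ℝ) = 2 ^ (5 * M + u - (5 * M + v)) * (1 / 2 ^ (5 * M + u) * 2 ^ (5 * M + v)) := by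
                  rw [e]; field_simp
              _ ≤ _ := by gcongr
        _ = ∑ q ∈ T, f q u * g q v := by
            rw [Finset.sum_congr rfl (g := fun _ => (1:ℝ) / 2 ^ (5 * M + u) * 2 ^ (5 * M + v)),
              Finset.sum_const, nsmul_eq_mul]
            intro q hq
            rw [hT, Finset.mem_filter, Finset.mem_Icc] at hq
            have : (q:ℝ) ≤ 2 ^ (5 * M + u) := by exact_mod_cast hq.1.2
            simp only [f, g]
            rw [if_pos this, if_pos hq.2]
        _ ≤ _ := Finset.sum_le_sum_of_subset_of_nonneg hTB (fun q _ _ => mul_nonneg (hf0 q u) (hg0 q v))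
    have h6 := Finset.card_nsmul_le_sum _ _ _ h5
    rw [Finset.card_range, nsmul_eq_mul, mul_one] at h6
    push_cast at h6
    refine h6.trans ?_
    apply Finset.sum_le_sum_of_subset_of_nonneg
    · intro v hv; rw [Finset.mem_range] at *; omega
    · intro v _ _
      exact Finset.sum_nonneg (fun q _ => mul_nonneg (hf0 q u) (hg0 q v))
  have h7 := (Finset.sum_le_sum h4).trans h2
  have h8 : ∀ n : ℕ, ∑ u ∈ Finset.range n, ((u:ℝ) + 1) = n * (n + 1) / 2 := by
    intro n
    induction n with
    | zero => simp
    | succ n ih => rw [Finset.sum_range_succ, ih]; push_cast; ring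
  rw [h8] at h7
  push_cast at h7
  have hM : (0:ℝ) ≤ M := Nat.cast_nonneg M
  nlinarith

lemma sum_inv_sq (n : ℕ) : ∑ g ∈ Finset.Icc 1 n, 1 / (g:ℝ) ^ 2 ≤ 2 - 1 / (n:ℝ) := by
  induction n with
  | zero => simp
  | succ n ih =>
    rw [Finset.sum_Icc_succ_top (by omega)]
    rcases Nat.eq_zero_or_pos n with rfl | hn
    · norm_num
    · have hn0 : (0:ℝ) < n := by exact_mod_cast hn
      have : 1 / ((n+1 : ℕ):ℝ) ^ 2 ≤ 1 / n - 1 / ((n+1 : ℕ):ℝ) := by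
        push_cast
        rw [div_sub_div _ _ (by positivity) (by positivity), div_le_div_iff₀ (by positivity) (by positivity)]
        nlinarith
      linarith

open Classical in
noncomputable def QQ (α : ℝ) (M : ℕ) : Finset ℕ :=
  (Finset.Icc 1 (2 ^ (6 * M))).filter (fun q : ℕ => ∃ l : ℤ, IsCoprime (q:ℤ) l ∧ |(q:ℝ) * α - l| ≤ 1 / 2 ^ (5 * M))

open Classical in
lemma mem_QQ (α : ℝ) (M q : ℕ) : q ∈ QQ α M ↔ (1 ≤ q ∧ q ≤ 2 ^ (6 * M)) ∧
    ∃ l : ℤ, IsCoprime (q:ℤ) l ∧ |(q:ℝ) * α - l| ≤ 1 / 2 ^ (5 * M) := by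
  rw [QQ, Finset.mem_filter, Finset.mem_Icc]

lemma sum_QQ (α c : ℝ) (hc : 0 < c)
    (hα : ∀ q : ℕ, 1 ≤ q → c ≤ (q : ℝ) * nint (q * α)) (M : ℕ) :
    (M:ℝ) ^ 2 / 16 ≤ ∑ q ∈ QQ α M, 1 / ((q:ℝ) * nint (q * α)) := by
  have hB := sum_B α c hc hα M
  set B := (Finset.Icc 1 (2 ^ (6 * M))).filter (fun q : ℕ => nint (q * α) ≤ 1 / 2 ^ (5 * M)) with hBdef
  let G : ℕ → ℕ := fun q => Int.gcd (q:ℤ) (round ((q:ℝ) * α))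
  have hYpos : ∀ q : ℕ, 1 ≤ q → 0 < nint (q * α) := by
    intro q hq
    have hY := hα q hq
    rcases (nint_nonneg (q * α)).lt_or_eq with h | h
    · exact h
    · rw [← h] at hY; linarith
  have key : ∀ q ∈ B, 1 ≤ G q ∧ G q ≤ 2 ^ (6 * M) ∧ q = (q / G q) * G q ∧ q / G q ∈ QQ α M ∧
      1 / ((q:ℝ) * nint (q * α)) ≤ 1 / (((q / G q : ℕ):ℝ) * nint ((q / G q : ℕ) * α)) * (1 / (G q : ℝ) ^ 2) := by
    intro q hq
    rw [hBdef, Finset.mem_filter, Finset.mem_Icc] at hq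
    obtain ⟨⟨hq1, hq2⟩, hq3⟩ := hq
    have hGpos : 0 < G q := Int.gcd_pos_of_ne_zero_left _ (by omega)
    have hGd : G q ∣ q := by
      have := Int.gcd_dvd_left (a := (q:ℤ)) (b := round ((q:ℝ) * α))
      exact_mod_cast this
    have hGle : G q ≤ q := Nat.le_of_dvd hq1 hGd
    obtain ⟨q1, hq1e⟩ := hGd
    obtain ⟨r1, hr1⟩ := (Int.gcd_dvd_right (a := (q:ℤ)) (b := round ((q:ℝ) * α)))
    change _ = ((G q : ℕ):ℤ) * r1 at hr1
    have hdiv : q / G q = q1 := by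
      rw [Nat.div_eq_iff_eq_mul_right hGpos ⟨q1, hq1e⟩]; exact hq1e
    have hq1pos : 1 ≤ q1 := by
      rcases Nat.eq_zero_or_pos q1 with h | h
      · rw [h] at hq1e; omega
      · exact h
    rw [hdiv]
    have hcop : IsCoprime (q1:ℤ) r1 := by
      rw [Int.isCoprime_iff_gcd_eq_one]
      have h1 : Int.gcd ((G q : ℤ) * q1) ((G q : ℤ) * r1) = G q * Int.gcd q1 r1 := by
        rw [Int.gcd_mul_left]; simp
      have h2 : Int.gcd ((G q : ℤ) * q1) ((G q : ℤ) * r1) = G q := by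
        rw [← hr1]
        have : ((G q : ℤ) * q1) = (q:ℤ) := by exact_mod_cast hq1e.symm
        rw [this]
      rw [h2] at h1
      nlinarith
    have hGr : (0:ℝ) < G q := by exact_mod_cast hGpos
    have hqr : (q:ℝ) = G q * q1 := by exact_mod_cast hq1e
    have hrr : ((round ((q:ℝ) * α) : ℤ) : ℝ) = G q * r1 := by exact_mod_cast hr1
    have hYe : nint (q * α) = G q * |(q1:ℝ) * α - r1| := by
      rw [nint, hrr, hqr, ← abs_of_pos hGr, ← abs_mul, abs_of_pos hGr]
      congr 1; ring
    have hYle : nint (q1 * α) ≤ |(q1:ℝ) * α - r1| := nint_le _ _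
    have hG1 : (1:ℝ) ≤ G q := by exact_mod_cast hGpos
    refine ⟨hGpos, hGle.trans hq2, by rw [mul_comm]; exact hq1e, ?_, ?_⟩
    · rw [mem_QQ]
      refine ⟨⟨hq1pos, ?_⟩, r1, hcop, ?_⟩
      · refine le_trans ?_ hq2
        rw [hq1e]; exact Nat.le_mul_of_pos_left _ hGpos
      · refine le_trans ?_ hq3
        rw [hYe]
        exact le_mul_of_one_le_left (abs_nonneg _) hG1
    · rw [one_div_mul_one_div]
      have hq1r : (0:ℝ) < q1 := by exact_mod_cast hq1pos
      have := hYpos q1 hq1pos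
      apply one_div_le_one_div_of_le (by positivity)
      rw [hYe, hqr]
      calc (q1:ℝ) * nint (q1 * α) * (G q : ℝ) ^ 2 ≤ (q1:ℝ) * |(q1:ℝ) * α - r1| * (G q : ℝ) ^ 2 := by gcongr
        _ = _ := by ring
  let Fn : ℕ × ℕ → ℝ := fun p => 1 / ((p.1:ℝ) * nint (p.1 * α)) * (1 / (p.2:ℝ) ^ 2)
  have hFn : ∀ p, 0 ≤ Fn p := by
    intro p; simp only [Fn]
    have := nint_nonneg (p.1 * α)
    positivity
  have hinj : Set.InjOn (fun q => (q / G q, G q)) B := by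
    intro q hq q' hq' h
    simp only [Prod.mk.injEq] at h
    rw [(key q hq).2.2.1, (key q' hq').2.2.1, h.1, h.2]
  have h1 : ∑ q ∈ B, 1 / ((q:ℝ) * nint (q * α)) ≤ ∑ p ∈ (QQ α M) ×ˢ (Finset.Icc 1 (2 ^ (6 * M))), Fn p := by
    calc _ ≤ ∑ q ∈ B, Fn (q / G q, G q) := Finset.sum_le_sum (fun q hq => (key q hq).2.2.2.2)
      _ = ∑ p ∈ B.image (fun q => (q / G q, G q)), Fn p := (Finset.sum_image hinj).symm
      _ ≤ _ := by
        apply Finset.sum_le_sum_of_subset_of_nonneg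
        · intro p hp
          obtain ⟨q, hq, rfl⟩ := Finset.mem_image.1 hp
          rw [Finset.mem_product, Finset.mem_Icc]
          obtain ⟨a1, a2, a3, a4, _⟩ := key q hq
          exact ⟨a4, a1, a2⟩
        · intro p _ _; exact hFn p
  rw [Finset.sum_product] at h1
  simp only [Fn, ← Finset.mul_sum, ← Finset.sum_mul] at h1
  have h2 := sum_inv_sq (2 ^ (6 * M))
  have h3 : (0:ℝ) ≤ 1 / ((2 ^ (6 * M) : ℕ):ℝ) := by positivity
  have h4 : 0 ≤ ∑ q ∈ QQ α M, 1 / ((q:ℝ) * nint (q * α)) :=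
    Finset.sum_nonneg (fun q _ => by have := nint_nonneg (q * α); positivity)
  have h5 := hB.trans (h1.trans (mul_le_mul_of_nonneg_left (h2.trans (by linarith : _ ≤ (2:ℝ))) h4))
  linarith

lemma rotation_count (θ η : ℝ) (N d : ℕ) (s P0 : ℤ) (hcop : IsCoprime s (d:ℤ)) (hd1 : 1 ≤ d) (hdN : d ≤ N)
    (hθ : |θ - s / d| ≤ 1 / (N * d)) (hηd : 1 ≤ η * d) (S : Finset ℤ)
    (hS : ∀ p ∈ S, P0 ≤ p ∧ p < P0 + N ∧ ∃ p' : ℤ, |p * θ - p'| ≤ η) :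
    (S.card : ℝ) ≤ 12 * N * η := by
  choose! g hg using fun p hp => (hS p hp).2.2
  have hd0 : (0:ℝ) < d := by exact_mod_cast hd1
  have hN0 : (0:ℝ) < N := by exact_mod_cast (lt_of_lt_of_le hd1 hdN)
  have hdz : (0:ℤ) < d := by exact_mod_cast hd1
  let b : ℤ → ℤ := fun p => (p - P0) / d
  let i : ℤ → ℤ := fun p => (p - P0) % d
  let z : ℤ → ℝ := fun k => d * ((P0 + d * k : ℤ) : ℝ) * θ
  let h : ℤ → ℤ := fun p => i p * s - d * g p + ⌊z (b p)⌋
  have hbi : ∀ p, p = P0 + d * b p + i p := by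
    intro p
    have := Int.mul_ediv_add_emod (p - P0) d
    show p = P0 + d * ((p - P0) / d) + (p - P0) % d
    linarith
  have hi0 : ∀ p, 0 ≤ i p := fun p => Int.emod_nonneg _ hdz.ne'
  have hid : ∀ p, i p < d := fun p => Int.emod_lt_of_pos _ hdz
  have hinj : Set.InjOn (fun p => (b p, h p)) S := by
    intro p hp p' hp' heq
    simp only [Prod.mk.injEq] at heq
    obtain ⟨h1, h2⟩ := heq
    have h3 : i p * s - d * g p + ⌊z (b p)⌋ = i p' * s - d * g p' + ⌊z (b p')⌋ := h2
    rw [h1] at h3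
    have h4 : (d:ℤ) ∣ s * (i p - i p') := ⟨g p - g p', by linarith⟩
    have h5 : (d:ℤ) ∣ i p - i p' := hcop.symm.dvd_of_dvd_mul_left h4
    have h6 : i p - i p' = 0 := by
      apply Int.eq_zero_of_abs_lt_dvd h5
      rw [abs_lt]; constructor <;> linarith [hi0 p, hi0 p', hid p, hid p']
    rw [hbi p, hbi p', h1]; linarith
  set B : Finset ℤ := Finset.Icc 0 (((N - 1 : ℕ) : ℤ) / d) with hB
  set C : Finset ℤ := Finset.Icc ⌈-(d * η + 1) - 1⌉ ⌊d * η + 1⌋ with hC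
  have hmaps : ∀ p ∈ S, (b p, h p) ∈ B ×ˢ C := by
    intro p hp
    rw [Finset.mem_product]
    obtain ⟨h1, h2, _⟩ := hS p hp
    constructor
    · show (p - P0) / d ∈ B
      rw [hB, Finset.mem_Icc]
      constructor
      · exact Int.ediv_nonneg (by linarith) hdz.le
      · apply Int.ediv_le_ediv hdz
        omega
    · have key : (i p:ℝ) * s - d * g p + z (b p) = d * (p * θ - g p) - i p * (d * (θ - s / d)) := by
        have : (p:ℝ) = ((P0 + d * b p : ℤ):ℝ) + i p := by exact_mod_cast hbi p
        show (i p:ℝ) * s - d * g p + d * ((P0 + d * b p : ℤ) : ℝ) * θ = _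
        rw [this]; field_simp; ring
      have e1 : |(d:ℝ) * (p * θ - g p)| ≤ d * η := by
        rw [abs_mul, abs_of_pos hd0]; gcongr; exact hg p hp
      have e2 : |(i p : ℝ) * (d * (θ - s / d))| ≤ 1 := by
        have hi0' : (0:ℝ) ≤ i p := by exact_mod_cast hi0 p
        have hid' : (i p:ℝ) ≤ d := by exact_mod_cast (hid p).le
        rw [abs_mul, abs_mul, abs_of_pos hd0, abs_of_nonneg hi0']
        calc (i p:ℝ) * (d * |θ - s / d|) ≤ d * (d * (1 / (N * d))) := by gcongr
          _ = d / N := by field_simp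
          _ ≤ 1 := by rw [div_le_one hN0]; exact_mod_cast hdN
      have e3 := abs_le.1 e1
      have e4 := abs_le.1 e2
      have f1 := Int.floor_le (z (b p))
      have f2 := Int.lt_floor_add_one (z (b p))
      have hh : ((h p : ℤ):ℝ) = (i p:ℝ) * s - d * g p + ⌊z (b p)⌋ := by
        show ((i p * s - d * g p + ⌊z (b p)⌋ : ℤ):ℝ) = _
        push_cast; ring
      rw [hC, Finset.mem_Icc]
      constructor
      · rw [Int.ceil_le, hh]; linarith
      · rw [Int.le_floor, hh]; linarith
  have hle := Finset.card_le_card_of_injOn (fun p => (b p, h p)) hmaps hinj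
  rw [Finset.card_product] at hle
  have hle' : (S.card : ℝ) ≤ B.card * C.card := by exact_mod_cast hle
  have hBc : (B.card : ℝ) ≤ 2 * N / d := by
    have h1 := card_int_le 0 (N / d) (by positivity) B (by
      intro k hk
      rw [hB, Finset.mem_Icc] at hk
      refine ⟨by exact_mod_cast hk.1, ?_⟩
      rw [le_div_iff₀ hd0]
      have h2 := (Int.le_ediv_iff_mul_le hdz).1 hk.2
      have h3 : k * (d:ℤ) ≤ N := by omega
      exact_mod_cast h3)
    have h2 : (1:ℝ) ≤ N / d := by rw [le_div_iff₀ hd0, one_mul]; exact_mod_cast hdN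
    have h3 : 2 * (N:ℝ) / d = 2 * (N / d) := by ring
    rw [h3]; linarith
  have hCc : (C.card : ℝ) ≤ 6 * (η * d) := by
    have h1 := card_int_le (-(d * η + 1) - 1) (d * η + 1) (by nlinarith) C (by
      intro k hk
      rw [hC, Finset.mem_Icc] at hk
      exact ⟨Int.ceil_le.1 hk.1, Int.le_floor.1 hk.2⟩)
    nlinarith
  calc (S.card : ℝ) ≤ B.card * C.card := hle'
    _ ≤ (2 * N / d) * (6 * (η * d)) :=
      mul_le_mul hBc hCc (Nat.cast_nonneg _) (div_nonneg (by linarith) hd0.le)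
    _ = 12 * N * η * (d / d) := by ring
    _ = 12 * N * η := by rw [div_self hd0.ne', mul_one]

open Classical in
noncomputable def FF (T R : ℕ) (i : ℤ) (q : ℕ) (x : ℝ) : Finset ℤ :=
  (Finset.Ico (i * R) ((i+1) * R)).filter (fun k : ℤ => ∃ p : ℤ, |(q:ℝ) * (k / (T * R)) - p| ≤ x)

open Classical in
lemma mem_FF (T R : ℕ) (i : ℤ) (q : ℕ) (x : ℝ) (k : ℤ) : k ∈ FF T R i q x ↔
    (i * R ≤ k ∧ k < (i+1) * R) ∧ ∃ p : ℤ, |(q:ℝ) * (k / (T * R)) - p| ≤ x := by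
  rw [FF, Finset.mem_filter, Finset.mem_Ico]

lemma single_lower (T R : ℕ) (hT : 1 ≤ T) (hR : 1 ≤ R) (i : ℤ) (q : ℕ) (x : ℝ) (hx0 : 0 < x)
    (hx : x < 1 / 4) (hq : 12 * (T:ℝ) ≤ q) (hxW : (q:ℝ) ≤ x * (T * R)) :
    x * R / 2 ≤ (FF T R i q x).card := by
  have hT0 : (0:ℝ) < T := by exact_mod_cast hT
  have hR0 : (0:ℝ) < R := by exact_mod_cast hR
  have hq0 : (0:ℝ) < q := by linarith
  set W : ℝ := T * R with hW
  have hW0 : 0 < W := by positivity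
  set P : Finset ℤ := Finset.Icc ⌈(q:ℝ) * i / T + 1⌉ ⌊(q:ℝ) * (i+1) / T - 1⌋ with hP
  let G : ℤ → Finset ℤ := fun p => Finset.Icc ⌈(p - x) * W / q⌉ ⌊(p + x) * W / q⌋
  have hG : ∀ p k, k ∈ G p ↔ |(q:ℝ) * (k / W) - p| ≤ x := by
    intro p k
    simp only [G, Finset.mem_Icc, Int.ceil_le, Int.le_floor, div_le_iff₀ hq0, le_div_iff₀ hq0, abs_le]
    have e : (q:ℝ) * (k / W) = k * q / W := by ring
    rw [e, le_sub_iff_add_le, le_div_iff₀ hW0, sub_le_iff_le_add, div_le_iff₀ hW0]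
    constructor
    · rintro ⟨h1, h2⟩; constructor <;> linarith
    · rintro ⟨h1, h2⟩; constructor <;> linarith
  have hPcard : (q:ℝ) / T - 3 ≤ P.card := by
    have h1 := card_int_ge ((q:ℝ) * i / T + 1) ((q:ℝ) * (i+1) / T - 1) P (by
      intro p h1 h2
      rw [hP, Finset.mem_Icc]
      exact ⟨Int.ceil_le.2 h1, Int.le_floor.2 h2⟩)
    have e : (q:ℝ) * (i+1) / T - 1 - ((q:ℝ) * i / T + 1) - 1 = q / T - 3 := by ring
    linarith
  have hsub : P.biUnion G ⊆ FF T R i q x := by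
    intro k hk
    rw [Finset.mem_biUnion] at hk
    obtain ⟨p, hp, hk⟩ := hk
    rw [hG] at hk
    rw [mem_FF]
    refine ⟨?_, p, hk⟩
    rw [hP, Finset.mem_Icc, Int.ceil_le, Int.le_floor] at hp
    rw [abs_le] at hk
    have h1 : (q:ℝ) * i / T < q * (k / W) := by linarith
    have h2 : (q:ℝ) * (k / W) < q * (i+1) / T := by linarith
    have e1 : (q:ℝ) * i / T = q * (i * R / W) := by rw [hW]; field_simp
    have e2 : (q:ℝ) * (i+1) / T = q * ((i+1) * R / W) := by rw [hW]; field_simp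
    rw [e1] at h1
    rw [e2] at h2
    have h3 := (div_lt_div_iff_of_pos_right hW0).1 (lt_of_mul_lt_mul_left h1 hq0.le)
    have h4 := (div_lt_div_iff_of_pos_right hW0).1 (lt_of_mul_lt_mul_left h2 hq0.le)
    constructor
    · have : i * (R:ℤ) < k := by exact_mod_cast h3
      exact this.le
    · exact_mod_cast h4
  have hdisj : (P : Set ℤ).PairwiseDisjoint G := by
    intro p _ p' _ hpp
    rw [Function.onFun, Finset.disjoint_left]
    intro k hk hk'
    rw [hG, abs_le] at hk hk'
    apply hpp
    have h1 : |(p:ℝ) - p'| < 1 := by rw [abs_lt]; constructor <;> linarith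
    have h2 : |p - p'| < 1 := by exact_mod_cast h1
    rw [Int.abs_lt_one_iff] at h2
    omega
  have hGcard : ∀ p ∈ P, x * W / q ≤ ((G p).card : ℝ) := by
    intro p _
    have h1 := card_int_ge ((p - x) * W / q) ((p + x) * W / q) (G p) (by
      intro k h1 h2
      simp only [G, Finset.mem_Icc]
      exact ⟨Int.ceil_le.2 h1, Int.le_floor.2 h2⟩)
    have e : (p + x) * W / q - (p - x) * W / q - 1 = 2 * (x * W / q) - 1 := by ring
    have h2 : 1 ≤ x * W / q := by rw [le_div_iff₀ hq0]; linarith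
    linarith
  have h1 := Finset.card_le_card hsub
  rw [Finset.card_biUnion hdisj] at h1
  have h2 : ((∑ p ∈ P, (G p).card : ℕ):ℝ) ≤ (FF T R i q x).card := by exact_mod_cast h1
  push_cast at h2
  have h3 := Finset.card_nsmul_le_sum P _ _ hGcard
  rw [nsmul_eq_mul] at h3
  have h4 : 12 ≤ (q:ℝ) / T := by rw [le_div_iff₀ hT0]; exact hq
  have h5 : (q:ℝ) / T / 2 ≤ P.card := by linarith
  have h6 : (q:ℝ) / T / 2 * (x * W / q) ≤ P.card * (x * W / q) := by gcongr
  have h7 : (q:ℝ) / T / 2 * (x * W / q) = x * R / 2 := by rw [hW]; field_simp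
  linarith

lemma overlap (T R : ℕ) (hT : 1 ≤ T) (hR : 1 ≤ R) (i : ℤ) (q q' : ℕ) (x x' : ℝ) (hx0 : 0 < x) (hx0' : 0 < x')
    (hx : x < 1 / 4) (hx' : x' < 1 / 4) (hq1 : 1 ≤ q') (hqq : q' < q) (hq : 12 * (T:ℝ) ≤ q)
    (hxW : (q:ℝ) ≤ x * (T * R)) (hxW' : (q':ℝ) ≤ x' * (T * R))
    (hrot : ∀ (d : ℕ) (s : ℤ), IsCoprime s (d:ℤ) → 1 ≤ d → |(d:ℝ) * q' - s * q| ≤ T →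
      1 ≤ x' * d) :
    (((FF T R i q x) ∩ (FF T R i q' x')).card : ℝ) ≤ 144 * (x * x') * R := by
  have hT0 : (0:ℝ) < T := by exact_mod_cast hT
  have hR0 : (0:ℝ) < R := by exact_mod_cast hR
  have hq0 : (0:ℝ) < q := by linarith
  have hq0' : (0:ℝ) < q' := by exact_mod_cast hq1
  have hqqr : (q':ℝ) < q := by exact_mod_cast hqq
  set W : ℝ := T * R with hW
  have hW0 : 0 < W := by positivity
  set E := (FF T R i q x) ∩ (FF T R i q' x') with hE
  have hmem : ∀ k ∈ E, (i * R ≤ k ∧ k < (i+1) * R) ∧ (∃ p : ℤ, |(q:ℝ) * (k / W) - p| ≤ x) ∧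
      ∃ p' : ℤ, |(q':ℝ) * (k / W) - p'| ≤ x' := by
    intro k hk
    rw [hE, Finset.mem_inter, mem_FF, mem_FF] at hk
    exact ⟨hk.1.1, hk.1.2, hk.2.2⟩
  choose! f hf using fun k hk => (hmem k hk).2.1
  choose! f' hf' using fun k hk => (hmem k hk).2.2
  set θ : ℝ := q' / q with hθ
  have hθ0 : 0 < θ := by positivity
  have hθ1 : θ < 1 := by rw [hθ, div_lt_one hq0]; exact hqqr
  set η : ℝ := x' + x * θ with hη
  have hη2 : η < 1 / 2 := by nlinarith
  have hηx : x' ≤ η := by rw [hη]; nlinarith [mul_pos hx0 hθ0]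
  have hrel : ∀ k ∈ E, |(f k : ℝ) * θ - f' k| ≤ η := by
    intro k hk
    have h1 := hf k hk
    have h2 := hf' k hk
    have e : (f k : ℝ) * θ - f' k = ((q':ℝ) * (k / W) - f' k) - ((q:ℝ) * (k / W) - f k) * θ := by
      rw [hθ]; field_simp; ring
    rw [e]
    refine (abs_sub _ _).trans ?_
    rw [abs_mul, abs_of_pos hθ0, hη]
    gcongr
  set N : ℕ := ⌊(q:ℝ) / T⌋₊ + 3 with hN
  have hNlow : (q:ℝ) / T ≤ N := by
    have := Nat.lt_floor_add_one ((q:ℝ) / T)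
    rw [hN]; push_cast; linarith
  have hqT : 12 ≤ (q:ℝ) / T := by rw [le_div_iff₀ hT0]; exact hq
  have hNup : (N:ℝ) ≤ 2 * (q / T) := by
    have := Nat.floor_le (by positivity : 0 ≤ (q:ℝ) / T)
    rw [hN]; push_cast; linarith
  set P0 : ℤ := ⌈(q:ℝ) * i / T - 1⌉ with hP0
  obtain ⟨r, hr1, hr2⟩ := Real.exists_rat_abs_sub_le_and_den_le θ (n := N) (by omega)
  have hden : (0:ℝ) < r.den := by exact_mod_cast r.den_pos
  have hN0 : (0:ℝ) < N := by rw [hN]; positivity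
  have hrr : (r:ℝ) = (r.num : ℝ) / (r.den : ℝ) := by
    exact_mod_cast (Rat.cast_def (K := ℝ) r)
  rw [hrr] at hr1
  have hcop : IsCoprime r.num (r.den:ℤ) := by
    rw [Int.isCoprime_iff_gcd_eq_one]
    exact r.reduced
  have hr3 : |θ - (r.num:ℝ) / (r.den:ℝ)| ≤ 1 / (N * r.den) := by
    refine hr1.trans ?_
    apply one_div_le_one_div_of_le (by positivity)
    nlinarith
  have hd : 1 ≤ x' * r.den := by
    apply hrot r.den r.num hcop r.den_pos
    have e : (r.den:ℝ) * q' - r.num * q = (θ - (r.num:ℝ) / (r.den:ℝ)) * (q * r.den) := by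
      rw [hθ]; field_simp
    rw [e, abs_mul, abs_of_pos (by positivity : (0:ℝ) < q * r.den)]
    calc _ ≤ 1 / ((N:ℝ) * r.den) * (q * r.den) := by gcongr
      _ = q / N := by field_simp
      _ ≤ T := by
        rw [div_le_iff₀ hN0]
        rw [div_le_iff₀ hT0] at hNlow
        linarith
  have hcardP : ((E.image f).card : ℝ) ≤ 12 * N * η := by
    apply rotation_count θ η N r.den r.num P0 hcop r.den_pos hr2 hr3
    · exact hd.trans (by gcongr)
    · intro p hp
      obtain ⟨k, hk, rfl⟩ := Finset.mem_image.1 hp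
      have h1 := abs_le.1 (hf k hk)
      obtain ⟨⟨a1, a2⟩, _⟩ := hmem k hk
      have b1 : (i:ℝ) * R ≤ k := by exact_mod_cast a1
      have b2 : (k:ℝ) ≤ (i + 1) * R := by exact_mod_cast a2.le
      have c1 : (q:ℝ) * i / T ≤ q * (k / W) := by
        have e1 : (q:ℝ) * i / T = q * (i * R / W) := by rw [hW]; field_simp
        rw [e1]; gcongr
      have c2 : (q:ℝ) * (k / W) ≤ q * i / T + q / T := by
        have e2 : (q:ℝ) * i / T + q / T = q * ((i+1) * R / W) := by rw [hW]; field_simp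
        rw [e2]; gcongr
      refine ⟨?_, ?_, f' k, hrel k hk⟩
      · rw [hP0, Int.ceil_le]; linarith
      · have h3 := Int.le_ceil ((q:ℝ) * i / T - 1)
        have h4 := Nat.lt_floor_add_one ((q:ℝ) / T)
        have : (f k : ℝ) < P0 + N := by
          rw [hN]; push_cast; linarith
        exact_mod_cast this
  have hfib : ∀ p ∈ E.image f, (((E.filter (fun k => f k = p)).card : ℕ) : ℝ) ≤ 3 * (x * W / q) ∧
      (((E.filter (fun k => f k = p)).card : ℕ) : ℝ) ≤ 3 * (x' * W / q') := by
    intro p hp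
    obtain ⟨k0, hk0, rfl⟩ := Finset.mem_image.1 hp
    have gen : ∀ (Q : ℝ) (X : ℝ) (c : ℤ), 0 < Q → 0 < X → Q ≤ X * W →
        (∀ k ∈ E.filter (fun k => f k = f k0), |Q * (k / W) - c| ≤ X) →
        (((E.filter (fun k => f k = f k0)).card : ℕ) : ℝ) ≤ 3 * (X * W / Q) := by
      intro Q X c hQ hX hXW h
      have h1 := card_int_le ((c - X) * W / Q) ((c + X) * W / Q) (by gcongr; linarith)
        (E.filter (fun k => f k = f k0)) (by
          intro k hk
          have h2 := abs_le.1 (h k hk)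
          have e : Q * (k / W) = k * Q / W := by ring
          rw [e, le_sub_iff_add_le, le_div_iff₀ hW0, sub_le_iff_le_add, div_le_iff₀ hW0] at h2
          rw [div_le_iff₀ hQ, le_div_iff₀ hQ]
          constructor <;> linarith)
      have e : (c + X) * W / Q - (c - X) * W / Q + 1 = 2 * (X * W / Q) + 1 := by ring
      have h3 : 1 ≤ X * W / Q := by rw [le_div_iff₀ hQ]; linarith
      linarith
    constructor
    · apply gen q x (f k0) hq0 hx0 hxW
      intro k hk
      rw [Finset.mem_filter] at hk
      rw [← hk.2]; exact hf k hk.1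
    · apply gen q' x' (f' k0) hq0' hx0' hxW'
      intro k hk
      rw [Finset.mem_filter] at hk
      have h1 := abs_le.1 (hrel k hk.1)
      have h2 := abs_le.1 (hrel k0 hk0)
      rw [hk.2] at h1
      have h3 : |(f' k:ℝ) - f' k0| < 1 := by rw [abs_lt]; constructor <;> linarith
      have h4 : |f' k - f' k0| < 1 := by exact_mod_cast h3
      rw [Int.abs_lt_one_iff] at h4
      have h5 : f' k = f' k0 := by omega
      rw [← h5]; exact hf' k hk.1
  set μ : ℝ := min (x * W / q) (x' * W / q') with hμ
  have hcard : (E.card : ℝ) ≤ (E.image f).card * (3 * μ) := by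
    have h1 := Finset.card_eq_sum_card_image f E
    have h2 : (E.card : ℝ) = ∑ p ∈ E.image f, ((E.filter (fun k => f k = p)).card : ℝ) := by
      exact_mod_cast h1
    rw [h2, ← nsmul_eq_mul]
    apply Finset.sum_le_card_nsmul
    intro p hp
    have := hfib p hp
    rw [hμ, mul_min_of_nonneg _ _ (by norm_num)]
    exact le_min this.1 this.2
  have hμ0 : 0 ≤ μ := by rw [hμ]; exact le_min (by positivity) (by positivity)
  have hη0 : 0 < η := by linarith
  calc (E.card : ℝ) ≤ (E.image f).card * (3 * μ) := hcard
    _ ≤ (12 * N * η) * (3 * μ) := by gcongr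
    _ ≤ (12 * (2 * (q / T)) * η) * (3 * μ) := by gcongr
    _ = 72 * (q / T) * (x' * μ) + 72 * (q' / T) * (x * μ) := by
        rw [hη, hθ]; field_simp; ring
    _ ≤ 72 * (q / T) * (x' * (x * W / q)) + 72 * (q' / T) * (x * (x' * W / q')) := by
        have := min_le_left (x * W / q) (x' * W / q')
        have := min_le_right (x * W / q) (x' * W / q')
        gcongr
    _ = 144 * (x * x') * R := by rw [hW]; field_simp; ring

lemma bonferroni (F : ℕ → Finset ℤ) (x : ℕ → ℝ) (R K : ℝ) (hR : 0 ≤ R) (hK : 0 ≤ K) (Q : Finset ℕ) :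
    (∀ q ∈ Q, 0 ≤ x q) → (∀ q ∈ Q, x q * R / 2 ≤ ((F q).card : ℝ)) →
    (∀ q ∈ Q, ∀ q' ∈ Q, q' < q → ((F q ∩ F q').card : ℝ) ≤ K * (x q * x q') * R) →
    R / 2 * (∑ q ∈ Q, x q) - K / 2 * R * (∑ q ∈ Q, x q) ^ 2 ≤ ((Q.biUnion F).card : ℝ) := by
  classical
  induction Q using Finset.induction_on_max with
  | empty => simp
  | insert m Q hm ih =>
    intro h0 h1 h2
    have hmQ : m ∉ Q := fun h => lt_irrefl _ (hm m h)
    have ih' := ih (fun q hq => h0 q (Finset.mem_insert_of_mem hq)) (fun q hq => h1 q (Finset.mem_insert_of_mem hq))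
      (fun q hq q' hq' => h2 q (Finset.mem_insert_of_mem hq) q' (Finset.mem_insert_of_mem hq'))
    rw [Finset.sum_insert hmQ, Finset.biUnion_insert]
    have e1 := Finset.card_union_add_card_inter (F m) (Q.biUnion F)
    have e2 : (((F m ∪ Q.biUnion F).card : ℝ)) + ((F m ∩ Q.biUnion F).card : ℝ) =
      (F m).card + (Q.biUnion F).card := by exact_mod_cast e1
    have e3 : ((F m ∩ Q.biUnion F).card : ℝ) ≤ K * x m * R * ∑ q ∈ Q, x q := by
      rw [Finset.inter_biUnion]
      have h3 : ((Q.biUnion (fun q => F m ∩ F q)).card : ℝ) ≤ ∑ q ∈ Q, ((F m ∩ F q).card : ℝ) := by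
        exact_mod_cast Finset.card_biUnion_le
      refine h3.trans ?_
      rw [Finset.mul_sum]
      apply Finset.sum_le_sum
      intro q hq
      refine (h2 m (Finset.mem_insert_self _ _) q (Finset.mem_insert_of_mem hq) (hm q hq)).trans (le_of_eq ?_)
      ring
    have e4 := h1 m (Finset.mem_insert_self _ _)
    have e5 : 0 ≤ K / 2 * R * x m ^ 2 := by positivity
    nlinarith

noncomputable def SQ (α : ℝ) (M : ℕ) : ℝ := ∑ q ∈ QQ α M, 1 / ((q:ℝ) * nint (q * α))

noncomputable def xq (α : ℝ) (M q : ℕ) : ℝ := 1 / 288 / (SQ α M * ((q:ℝ) * nint (q * α)))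

def Hit (α : ℝ) (M : ℕ) (k : ℤ) : Prop :=
  ∃ q ∈ QQ α M, ∃ p : ℤ, |(q:ℝ) * (k / 2 ^ (10 * M)) - p| ≤ xq α M q

set_option maxHeartbeats 2000000 in
open Classical in
lemma hit_lower (α c : ℝ) (hc : 0 < c)
    (hα : ∀ q : ℕ, 1 ≤ q → c ≤ (q : ℝ) * nint (q * α)) :
    ∃ M1 : ℕ, ∀ M ≥ M1, ∀ i : ℤ, (1 / 1152 : ℝ) * ((2 ^ (9 * M) : ℕ) : ℝ) ≤
      ((Finset.Ico (i * ((2 ^ (9 * M) : ℕ) : ℤ)) ((i+1) * ((2 ^ (9 * M) : ℕ) : ℤ))).filter (Hit α M)).card := by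
  have hc1 : c ≤ 1 := by
    have h1 := hα 1 le_rfl
    have h2 := nint_le_half ((1:ℕ) * α)
    push_cast at h1 h2
    linarith
  refine ⟨⌈10 ^ 4 / c ^ 3⌉₊ + 1, fun M hM i => ?_⟩
  have hM1 : (1:ℝ) ≤ M := by exact_mod_cast (by omega : 1 ≤ M)
  have hMc : 10 ^ 4 / c ^ 3 ≤ M := by
    refine (Nat.le_ceil _).trans ?_
    have h0 : ⌈10 ^ 4 / c ^ 3⌉₊ ≤ M := by omega
    exact Nat.cast_le.2 h0
  rw [div_le_iff₀ (by positivity)] at hMc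
  set t : ℝ := 2 ^ M with ht
  have htM : (M:ℝ) ≤ t := by
    have := (Nat.lt_two_pow_self (n := M)).le
    rw [ht]; exact_mod_cast this
  have ht1 : 1 ≤ t := hM1.trans htM
  have ht0 : 0 < t := by linarith
  have hc3 : c ^ 3 ≤ c := by nlinarith [sq_nonneg c, mul_pos hc hc]
  have hc2 : c ^ 3 ≤ c ^ 2 := by nlinarith [sq_nonneg c, mul_pos hc hc]
  have hct3 : 10 ^ 4 ≤ c ^ 3 * t := by nlinarith [pow_pos hc 3]
  have hct : 10 ^ 4 ≤ c * t := by nlinarith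
  have hct2 : 10 ^ 4 ≤ c ^ 2 * t := by nlinarith
  have p5 : (2:ℝ) ^ (5 * M) = t ^ 5 := by rw [ht, ← pow_mul]; congr 1; ring
  have p6 : (2:ℝ) ^ (6 * M) = t ^ 6 := by rw [ht, ← pow_mul]; congr 1; ring
  have p9 : (2:ℝ) ^ (9 * M) = t ^ 9 := by rw [ht, ← pow_mul]; congr 1; ring
  have p10 : (2:ℝ) ^ (10 * M) = t ^ 10 := by rw [ht, ← pow_mul]; congr 1; ring
  -- basic facts on members
  have hfacts : ∀ q ∈ QQ α M, 1 ≤ q ∧ (q:ℝ) ≤ t ^ 6 ∧ 0 < nint (q * α) ∧ nint (q * α) ≤ 1 / t ^ 5 ∧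
      12 * t ≤ q := by
    intro q hq
    rw [mem_QQ] at hq
    obtain ⟨⟨h1, h2⟩, l, _, h3⟩ := hq
    have hY := hα q h1
    have hYp : 0 < nint (q * α) := by
      rcases (nint_nonneg (q * α)).lt_or_eq with h | h
      · exact h
      · rw [← h] at hY; linarith
    have hYu : nint (q * α) ≤ 1 / t ^ 5 := by
      rw [← p5]; exact (nint_le _ l).trans h3
    refine ⟨h1, ?_, hYp, hYu, ?_⟩
    · rw [← p6]; exact_mod_cast h2
    · have hq0 : (0:ℝ) ≤ q := Nat.cast_nonneg q
      have h4 : c ≤ q * (1 / t ^ 5) := hY.trans (by gcongr)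
      rw [mul_one_div, le_div_iff₀ (by positivity)] at h4
      refine le_trans ?_ h4
      have : (1:ℝ) ≤ t ^ 3 := one_le_pow₀ ht1
      have e : c * t ^ 5 = (c * t) * t ^ 3 * t := by ring
      rw [e]
      have : 12 ≤ (c * t) * t ^ 3 := by nlinarith
      gcongr
  have hSlow : (M:ℝ) ^ 2 / 16 ≤ SQ α M := sum_QQ α c hc hα M
  have hcS : 625 ≤ c * SQ α M := by
    have : 10 ^ 4 ≤ c * (M:ℝ) ^ 2 := by nlinarith [pow_pos hc 3]
    nlinarith
  have hS0 : 0 < SQ α M := by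
    by_contra h; push Not at h; nlinarith
  have hSup : SQ α M ≤ 4 * t / c ^ 2 := by
    have h1 : SQ α M ≤ (QQ α M).card • (1 / c) := by
      apply Finset.sum_le_card_nsmul
      intro q hq
      exact one_div_le_one_div_of_le hc (hα q (hfacts q hq).1)
    rw [nsmul_eq_mul] at h1
    have h2 := count_Y α c hc hα (t ^ 6) (1 / t ^ 5) (QQ α M) (fun q hq => by
      obtain ⟨a1, a2, a3, a4, _⟩ := hfacts q hq
      exact ⟨a1, a2, a4⟩) (by positivity) (by positivity)
    calc _ ≤ _ := h1
      _ ≤ 4 / c * (t ^ 6 * (1 / t ^ 5)) * (1 / c) := by gcongr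
      _ = _ := by field_simp
  have hx0 : ∀ q ∈ QQ α M, 0 < xq α M q := by
    intro q hq
    obtain ⟨a1, a2, a3, a4, _⟩ := hfacts q hq
    have : (0:ℝ) < q := by exact_mod_cast a1
    rw [xq]; positivity
  have hx4 : ∀ q ∈ QQ α M, xq α M q < 1 / 4 := by
    intro q hq
    obtain ⟨a1, a2, a3, a4, _⟩ := hfacts q hq
    have : (0:ℝ) < q := by exact_mod_cast a1
    rw [xq, div_lt_iff₀ (by positivity)]
    have := mul_le_mul_of_nonneg_left (hα q a1) hS0.le
    nlinarith
  have hxlow : ∀ q ∈ QQ α M, c ^ 2 / (1152 * t ^ 2) ≤ xq α M q := by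
    intro q hq
    obtain ⟨a1, a2, a3, a4, _⟩ := hfacts q hq
    have hq0 : (0:ℝ) < q := by exact_mod_cast a1
    rw [xq, le_div_iff₀ (by positivity)]
    calc c ^ 2 / (1152 * t ^ 2) * (SQ α M * (q * nint (q * α)))
        ≤ c ^ 2 / (1152 * t ^ 2) * (4 * t / c ^ 2 * (t ^ 6 * (1 / t ^ 5))) := by gcongr
      _ = 1 / 288 := by field_simp; norm_num
  have hxW : ∀ q ∈ QQ α M, (q:ℝ) ≤ xq α M q * (((2 ^ M : ℕ):ℝ) * ((2 ^ (9 * M) : ℕ):ℝ)) := by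
    intro q hq
    obtain ⟨a1, a2, a3, a4, _⟩ := hfacts q hq
    push_cast
    rw [p9]
    calc (q:ℝ) ≤ t ^ 6 * 1 := by linarith
      _ ≤ t ^ 6 * (c ^ 2 * t ^ 2 / 1152) := by
        gcongr
        rw [le_div_iff₀ (by norm_num)]
        nlinarith
      _ = c ^ 2 / (1152 * t ^ 2) * (t * t ^ 9) := by field_simp
      _ ≤ _ := by gcongr; exact hxlow q hq
  have hrot : ∀ q ∈ QQ α M, ∀ q' ∈ QQ α M, q' < q → ∀ (d : ℕ) (s : ℤ), IsCoprime s (d:ℤ) → 1 ≤ d →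
      |(d:ℝ) * q' - s * q| ≤ ((2 ^ M : ℕ):ℝ) → 1 ≤ xq α M q' * d := by
    intro q hq q' hq' hlt d s hcop hd1 hds
    by_contra hcon
    push Not at hcon
    have hds' : |(d:ℝ) * q' - s * q| ≤ t := by rw [ht]; exact_mod_cast hds
    have hd0 : (0:ℝ) < d := by exact_mod_cast hd1
    have hd1r : (1:ℝ) ≤ d := by exact_mod_cast hd1
    have hdu : (d:ℝ) * c ^ 2 ≤ 1152 * t ^ 2 := by
      have h1 : c ^ 2 / (1152 * t ^ 2) * d ≤ 1 :=
        (mul_le_mul_of_nonneg_right (hxlow q' hq') hd0.le).trans hcon.le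
      rw [div_mul_eq_mul_div, div_le_one (by positivity)] at h1
      linarith
    have hqT := (hfacts q hq).2.2.2.2
    have hq0 : (0:ℝ) < q := by linarith
    have hltr : (q':ℝ) ≤ q := by exact_mod_cast hlt.le
    have hs : |(s:ℝ)| ≤ 2 * d := by
      have h1 : |(s:ℝ)| * q ≤ 2 * d * q := by
        rw [← abs_of_pos hq0, ← abs_mul, abs_of_pos hq0]
        have h2 : (s:ℝ) * q = d * q' - (d * q' - s * q) := by ring
        rw [h2]
        refine (abs_sub _ _).trans ?_
        rw [abs_of_nonneg (by positivity : (0:ℝ) ≤ d * q')]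
        have : (d:ℝ) * q' ≤ d * q := by gcongr
        have : (q:ℝ) ≤ d * q := by nlinarith
        linarith
      exact le_of_mul_le_mul_right h1 hq0
    obtain ⟨_, l, hl1, hl2⟩ := (mem_QQ α M q).1 hq
    obtain ⟨_, l', hl1', hl2'⟩ := (mem_QQ α M q').1 hq'
    rw [p5] at hl2 hl2'
    have hbound : |((d * q' - s * q : ℤ):ℝ) * α - ((d * l' - s * l : ℤ):ℝ)| ≤ 3 * d * (1 / t ^ 5) := by
      have e : ((d * q' - s * q : ℤ):ℝ) * α - ((d * l' - s * l : ℤ):ℝ) =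
        d * (q' * α - l') - s * (q * α - l) := by push_cast; ring
      rw [e]
      refine (abs_sub _ _).trans ?_
      rw [abs_mul, abs_mul, abs_of_pos hd0]
      calc _ ≤ (d:ℝ) * (1 / t ^ 5) + 2 * d * (1 / t ^ 5) := by gcongr
        _ = _ := by ring
    have hb2 : 3 * d * (1 / t ^ 5) * c ^ 2 ≤ 3456 / t ^ 3 := by
      calc 3 * d * (1 / t ^ 5) * c ^ 2 = 3 * (1 / t ^ 5) * (d * c ^ 2) := by ring
        _ ≤ 3 * (1 / t ^ 5) * (1152 * t ^ 2) := by gcongr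
        _ = _ := by field_simp; norm_num
    have he : (d * q' - s * q : ℤ) = 0 := by
      by_contra hne
      have h1 := bad_int α c hα _ (d * l' - s * l) hne
      have h2 : |((d * q' - s * q : ℤ):ℝ)| ≤ t := by push_cast; exact hds'
      have h3 : c ≤ t * (3 * d * (1 / t ^ 5)) := h1.trans (by gcongr)
      have h4 : c * c ^ 2 ≤ t * (3456 / t ^ 3) := by
        calc c * c ^ 2 ≤ t * (3 * d * (1 / t ^ 5)) * c ^ 2 := by gcongr
          _ = t * (3 * d * (1 / t ^ 5) * c ^ 2) := by ring
          _ ≤ _ := by gcongr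
      have e : t * (3456 / t ^ 3) = 3456 / t ^ 2 := by field_simp
      rw [e, le_div_iff₀ (by positivity)] at h4
      nlinarith
    have hm : (d * l' - s * l : ℤ) = 0 := by
      rw [he] at hbound
      rw [Int.cast_zero, zero_mul, zero_sub, abs_neg] at hbound
      have h1 : |((d * l' - s * l : ℤ):ℝ)| * c ^ 2 < 1 * c ^ 2 := by
        calc _ ≤ 3 * d * (1 / t ^ 5) * c ^ 2 := by gcongr
          _ ≤ 3456 / t ^ 3 := hb2
          _ < 1 * c ^ 2 := by
            rw [div_lt_iff₀ (by positivity)]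
            have : 1 ≤ t ^ 2 := one_le_pow₀ ht1
            nlinarith
      have h2 := lt_of_mul_lt_mul_right h1 (by positivity)
      have h3 : |(d * l' - s * l : ℤ)| < 1 := by exact_mod_cast h2
      exact Int.abs_lt_one_iff.1 h3
    have hds2 : (d:ℤ) ∣ s := by
      obtain ⟨u, v, huv⟩ := hl1
      have : s = d * (u * q' + v * l') := by
        calc s = s * (u * q + v * l) := by rw [huv, mul_one]
          _ = u * (s * q) + v * (s * l) := by ring
          _ = u * (d * q') + v * (d * l') := by
            rw [show s * (q:ℤ) = d * q' by linarith, show s * l = d * l' by linarith]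
          _ = _ := by ring
      exact ⟨_, this⟩
    have hunit : IsUnit (d:ℤ) := hcop.isUnit_of_dvd' hds2 dvd_rfl
    have hd : d = 1 := by
      have := Int.isUnit_iff.1 hunit
      omega
    rw [hd] at he
    push_cast at he
    have hq'1 := (hfacts q' hq').1
    have hs1 : 1 ≤ s := by
      by_contra h; push Not at h
      have : s * (q:ℤ) ≤ 0 := mul_nonpos_of_nonpos_of_nonneg (by omega) (by omega)
      omega
    have : (q:ℤ) ≤ s * q := le_mul_of_one_le_left (by omega) hs1
    omega
  have hT1 : 1 ≤ 2 ^ M := Nat.one_le_two_pow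
  have hR1 : 1 ≤ 2 ^ (9 * M) := Nat.one_le_two_pow
  have hTt : ((2 ^ M : ℕ):ℝ) = t := by rw [ht]; push_cast; rfl
  have hb := bonferroni (fun q => FF (2 ^ M) (2 ^ (9 * M)) i q (xq α M q)) (xq α M) ((2 ^ (9 * M) : ℕ):ℝ) 144
    (by positivity) (by norm_num) (QQ α M) (fun q hq => (hx0 q hq).le)
    (fun q hq => single_lower _ _ hT1 hR1 i q _ (hx0 q hq) (hx4 q hq) (by rw [hTt]; exact (hfacts q hq).2.2.2.2)
      (hxW q hq))
    (fun q hq q' hq' hlt => overlap _ _ hT1 hR1 i q q' _ _ (hx0 q hq) (hx0 q' hq') (hx4 q hq) (hx4 q' hq')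
      (hfacts q' hq').1 hlt (by rw [hTt]; exact (hfacts q hq).2.2.2.2) (hxW q hq) (hxW q' hq')
      (hrot q hq q' hq' hlt))
  have hsum : ∑ q ∈ QQ α M, xq α M q = 1 / 288 := by
    have h1 : ∀ q ∈ QQ α M, xq α M q = 1 / 288 / SQ α M * (1 / (q * nint (q * α))) := by
      intro q hq
      rw [xq, div_mul_eq_div_div, div_eq_mul_one_div]
    rw [Finset.sum_congr rfl h1, ← Finset.mul_sum]
    change 1 / 288 / SQ α M * SQ α M = _
    field_simp
  rw [hsum] at hb
  have hsub : (QQ α M).biUnion (fun q => FF (2 ^ M) (2 ^ (9 * M)) i q (xq α M q)) ⊆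
      (Finset.Ico (i * ((2 ^ (9 * M) : ℕ) : ℤ)) ((i+1) * ((2 ^ (9 * M) : ℕ) : ℤ))).filter (Hit α M) := by
    intro k hk
    rw [Finset.mem_biUnion] at hk
    obtain ⟨q, hq, hk⟩ := hk
    rw [mem_FF] at hk
    obtain ⟨hk1, p, hp⟩ := hk
    rw [Finset.mem_filter, Finset.mem_Ico]
    refine ⟨hk1, q, hq, p, ?_⟩
    have e : ((2 ^ M : ℕ):ℝ) * ((2 ^ (9 * M) : ℕ):ℝ) = 2 ^ (10 * M) := by
      push_cast; rw [← pow_add]; congr 1; ring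
    rw [e] at hp
    exact hp
  have hcard : (((QQ α M).biUnion (fun q => FF (2 ^ M) (2 ^ (9 * M)) i q (xq α M q))).card : ℝ) ≤
      ((Finset.Ico (i * ((2 ^ (9 * M) : ℕ) : ℤ)) ((i+1) * ((2 ^ (9 * M) : ℕ) : ℤ))).filter (Hit α M)).card := by
    exact_mod_cast Finset.card_le_card hsub
  refine le_trans (le_of_eq ?_) (hb.trans hcard)
  ring

lemma FF_upper (T R : ℕ) (hT : 1 ≤ T) (hR : 1 ≤ R) (i : ℤ) (q : ℕ) (y : ℝ) (hy0 : 0 ≤ y)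
    (hy : y ≤ 1) (hq : (T:ℝ) ≤ q) :
    ((FF T R i q y).card : ℝ) ≤ 4 * (q / T) * (2 * (y * (T * R) / q) + 1) := by
  have hT0 : (0:ℝ) < T := by exact_mod_cast hT
  have hR0 : (0:ℝ) < R := by exact_mod_cast hR
  have hq0 : (0:ℝ) < q := by linarith
  set W : ℝ := T * R with hW
  have hW0 : 0 < W := by positivity
  set E := FF T R i q y with hE
  have hmem : ∀ k ∈ E, (i * R ≤ k ∧ k < (i+1) * R) ∧ (∃ p : ℤ, |(q:ℝ) * (k / W) - p| ≤ y) := by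
    intro k hk
    rw [hE, mem_FF] at hk
    exact hk
  choose! f hf using fun k hk => (hmem k hk).2
  have hqT : 1 ≤ (q:ℝ) / T := by rw [le_div_iff₀ hT0]; linarith
  have hcardP : ((E.image f).card : ℝ) ≤ 4 * (q / T) := by
    have h0 := card_int_le ((q:ℝ) * i / T - 1) ((q:ℝ) * i / T + q / T + 1) (by linarith) (E.image f) (by
      intro p hp
      obtain ⟨k, hk, rfl⟩ := Finset.mem_image.1 hp
      have h1 := abs_le.1 (hf k hk)
      obtain ⟨⟨a1, a2⟩, _⟩ := hmem k hk
      have b1 : (i:ℝ) * R ≤ k := by exact_mod_cast a1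
      have b2 : (k:ℝ) ≤ (i + 1) * R := by exact_mod_cast a2.le
      have c1 : (q:ℝ) * i / T ≤ q * (k / W) := by
        have e1 : (q:ℝ) * i / T = q * (i * R / W) := by rw [hW]; field_simp
        rw [e1]; gcongr
      have c2 : (q:ℝ) * (k / W) ≤ q * i / T + q / T := by
        have e2 : (q:ℝ) * i / T + q / T = q * ((i+1) * R / W) := by rw [hW]; field_simp
        rw [e2]; gcongr
      constructor <;> linarith)
    linarith
  have hfib : ∀ p ∈ E.image f, (((E.filter (fun k => f k = p)).card : ℕ) : ℝ) ≤ 2 * (y * W / q) + 1 := by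
    intro p hp
    have h1 := card_int_le ((p - y) * W / q) ((p + y) * W / q) (by gcongr; linarith)
        (E.filter (fun k => f k = p)) (by
          intro k hk
          rw [Finset.mem_filter] at hk
          have h2 := abs_le.1 (hf k hk.1)
          rw [hk.2] at h2
          have e : (q:ℝ) * (k / W) = k * q / W := by ring
          rw [e, le_sub_iff_add_le, le_div_iff₀ hW0, sub_le_iff_le_add, div_le_iff₀ hW0] at h2
          rw [div_le_iff₀ hq0, le_div_iff₀ hq0]
          constructor <;> linarith)
    have e : (p + y) * W / q - (p - y) * W / q + 1 = 2 * (y * W / q) + 1 := by ring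
    linarith
  have h1 := Finset.card_eq_sum_card_image f E
  have h2 : (E.card : ℝ) = ∑ p ∈ E.image f, ((E.filter (fun k => f k = p)).card : ℝ) := by
    exact_mod_cast h1
  rw [h2]
  refine (Finset.sum_le_card_nsmul _ _ _ hfib).trans ?_
  rw [nsmul_eq_mul]
  gcongr

noncomputable def ww (a α : ℝ) (q : ℕ) : ℝ :=
  1 / ((q:ℝ) * (Real.log q) ^ (2 - a) * (Real.log (1 / nint (q * α))) ^ a * nint (q * α))

lemma ww_nonneg (a α : ℝ) (q : ℕ) : 0 ≤ ww a α q := by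
  have h1 : 0 ≤ (Real.log q) ^ (2 - a) := Real.rpow_nonneg (Real.log_natCast_nonneg q) _
  have h2 : 0 ≤ Real.log (1 / nint (q * α)) := by
    rcases (nint_nonneg (q * α)).lt_or_eq with h | h
    · apply Real.log_nonneg
      rw [le_div_iff₀ h]
      linarith [nint_le_half (q * α)]
    · rw [← h]; simp
  have h3 := Real.rpow_nonneg h2 a
  have h4 := nint_nonneg (q * α)
  rw [ww]; positivity

def Danger (a α : ℝ) (m : ℕ) (δ : ℝ) (k : ℤ) : Prop :=
  ∃ q ∈ Finset.Ico ((2:ℕ)^m) ((2:ℕ)^(10*m)), ∃ p : ℤ,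
    |(q:ℝ) * (k / 2 ^ (100 * m)) - p| ≤ δ * ww a α q + q / 2 ^ (100 * m)

open Classical in
lemma danger_upper (a : ℝ) (ha : 0 < a) (ha1 : a < 1) (α c : ℝ) (hc : 0 < c)
    (hα : ∀ q : ℕ, 1 ≤ q → c ≤ (q : ℝ) * nint (q * α)) (ε : ℝ) (hε : 0 < ε) :
    ∃ δ > 0, ∃ M2 : ℕ, ∀ m ≥ M2, ∀ i : ℤ,
      (((Finset.Ico (i * ((2 ^ (99 * m) : ℕ) : ℤ)) ((i+1) * ((2 ^ (99 * m) : ℕ) : ℤ))).filter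
        (Danger a α m δ)).card : ℝ) ≤ ε * ((2 ^ (99 * m) : ℕ) : ℝ) := by
  obtain ⟨K, hK, hsum⟩ := sum_upper a ha ha1 α c hc hα
  refine ⟨min (ε / (16 * K)) (1 / (2 * K)), lt_min (by positivity) (by positivity), ⌈24 / ε⌉₊ + 1, ?_⟩
  set δ := min (ε / (16 * K)) (1 / (2 * K)) with hδ
  have hδ0 : 0 < δ := lt_min (by positivity) (by positivity)
  have hδ1 : δ * (16 * K) ≤ ε := by
    rw [← le_div_iff₀ (by positivity)]; exact min_le_left _ _
  have hδ2 : δ * K ≤ 1 / 2 := by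
    have : δ * (2 * K) ≤ 1 := by
      rw [← le_div_iff₀ (by positivity)]; exact min_le_right _ _
    linarith
  intro m hm i
  have hm1 : 1 ≤ m := by omega
  have hS := hsum m hm1
  change ∑ q ∈ Finset.Ico ((2:ℕ)^m) ((2:ℕ)^(10*m)), ww a α q ≤ K at hS
  set I := Finset.Ico ((2:ℕ)^m) ((2:ℕ)^(10*m)) with hI
  set t : ℝ := 2 ^ m with ht
  have htm : (m:ℝ) ≤ t := by
    have := (Nat.lt_two_pow_self (n := m)).le
    rw [ht]; exact_mod_cast this
  have hmε : 24 / ε ≤ m := by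
    refine (Nat.le_ceil _).trans ?_
    have h0 : ⌈24 / ε⌉₊ ≤ m := by omega
    exact Nat.cast_le.2 h0
  have ht1 : 1 ≤ t := one_le_pow₀ one_le_two
  have ht2 : 2 ≤ t := by
    rw [ht]
    calc (2:ℝ) = 2 ^ 1 := by norm_num
      _ ≤ 2 ^ m := pow_le_pow_right₀ one_le_two hm1
  have ht0 : 0 < t := by linarith
  have p10 : (2:ℝ) ^ (10 * m) = t ^ 10 := by rw [ht, ← pow_mul]; congr 1; ring
  have p99 : (2:ℝ) ^ (99 * m) = t ^ 99 := by rw [ht, ← pow_mul]; congr 1; ring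
  have p100 : (2:ℝ) ^ (100 * m) = t ^ 100 := by rw [ht, ← pow_mul]; congr 1; ring
  have hTt : ((2 ^ m : ℕ):ℝ) = t := by rw [ht]; push_cast; rfl
  have hRt : ((2 ^ (99 * m) : ℕ):ℝ) = t ^ 99 := by rw [← p99]; push_cast; rfl
  have hqI : ∀ q ∈ I, t ≤ q ∧ (q:ℝ) ≤ t ^ 10 := by
    intro q hq
    rw [hI, Finset.mem_Ico] at hq
    constructor
    · rw [← hTt]; exact_mod_cast hq.1
    · rw [← p10]; exact_mod_cast hq.2.le
  let y : ℕ → ℝ := fun q => δ * ww a α q + q / t ^ 100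
  have hsub : (Finset.Ico (i * ((2 ^ (99 * m) : ℕ) : ℤ)) ((i+1) * ((2 ^ (99 * m) : ℕ) : ℤ))).filter
        (Danger a α m δ) ⊆ I.biUnion (fun q => FF (2 ^ m) (2 ^ (99 * m)) i q (y q)) := by
    intro k hk
    rw [Finset.mem_filter, Finset.mem_Ico] at hk
    obtain ⟨hk1, q, hq, p, hp⟩ := hk
    rw [Finset.mem_biUnion]
    refine ⟨q, hq, ?_⟩
    rw [mem_FF]
    refine ⟨hk1, p, ?_⟩
    rw [hTt, hRt, show t * t ^ 99 = t ^ 100 by ring]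
    rw [p100] at hp
    exact hp
  have hcard : ∀ q ∈ I, ((FF (2 ^ m) (2 ^ (99 * m)) i q (y q)).card : ℝ) ≤
      8 * δ * t ^ 99 * ww a α q + 12 * t ^ 10 := by
    intro q hq
    obtain ⟨h1, h2⟩ := hqI q hq
    have hq0 : (0:ℝ) < q := by linarith
    have hw := ww_nonneg a α q
    have hwK : ww a α q ≤ K :=
      (Finset.single_le_sum (f := ww a α) (fun j _ => ww_nonneg a α j) hq).trans hS
    have h3 : (q:ℝ) / t ^ 100 ≤ 1 / 2 := by
      rw [div_le_iff₀ (by positivity)]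
      have : 1 ≤ t ^ 89 := one_le_pow₀ ht1
      have e : t ^ 100 = t ^ 10 * (t * t ^ 89) := by ring
      rw [e]
      have h4 : 2 ≤ t * t ^ 89 := by nlinarith
      have : t ^ 10 * 2 ≤ t ^ 10 * (t * t ^ 89) := by gcongr
      linarith
    have hy0 : 0 ≤ y q := by simp only [y]; positivity
    have hy1 : y q ≤ 1 := by
      have : δ * ww a α q ≤ δ * K := by gcongr
      simp only [y]; linarith
    have h5 := FF_upper (2 ^ m) (2 ^ (99 * m)) Nat.one_le_two_pow Nat.one_le_two_pow i q (y q) hy0 hy1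
      (by rw [hTt]; exact h1)
    rw [hTt, hRt] at h5
    refine h5.trans ?_
    have e : 4 * ((q:ℝ) / t) * (2 * (y q * (t * t ^ 99) / q) + 1) =
        8 * δ * t ^ 99 * ww a α q + 12 * (q / t) := by
      simp only [y]; field_simp; ring
    rw [e]
    have : (q:ℝ) / t ≤ q := div_le_self hq0.le ht1
    linarith
  have h1 := (Finset.card_le_card hsub).trans Finset.card_biUnion_le
  have h2 : (((Finset.Ico (i * ((2 ^ (99 * m) : ℕ) : ℤ)) ((i+1) * ((2 ^ (99 * m) : ℕ) : ℤ))).filter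
        (Danger a α m δ)).card : ℝ) ≤ ∑ q ∈ I, ((FF (2 ^ m) (2 ^ (99 * m)) i q (y q)).card : ℝ) := by
    exact_mod_cast h1
  refine h2.trans ((Finset.sum_le_sum hcard).trans ?_)
  rw [Finset.sum_add_distrib, ← Finset.mul_sum, Finset.sum_const, nsmul_eq_mul, hRt]
  have hIc : (I.card : ℝ) ≤ t ^ 10 := by
    rw [hI, Nat.card_Ico, ← p10]
    have : 2 ^ (10 * m) - 2 ^ m ≤ 2 ^ (10 * m) := Nat.sub_le _ _
    exact_mod_cast this
  have hA : 8 * δ * t ^ 99 * ∑ q ∈ I, ww a α q ≤ ε / 2 * t ^ 99 := by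
    calc _ ≤ 8 * δ * t ^ 99 * K := by gcongr
      _ = (δ * (16 * K)) / 2 * t ^ 99 := by ring
      _ ≤ _ := by gcongr
  have hB : (I.card : ℝ) * (12 * t ^ 10) ≤ ε / 2 * t ^ 99 := by
    calc _ ≤ t ^ 10 * (12 * t ^ 10) := by gcongr
      _ = 12 * (t ^ 20 * 1) := by ring
      _ ≤ 12 * (t ^ 20 * t ^ 78) := by gcongr; exact one_le_pow₀ ht1
      _ = 12 * t ^ 98 := by ring
      _ ≤ (ε / 2 * t) * t ^ 98 := by
        gcongr
        have := hmε.trans htm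
        rw [div_le_iff₀ hε] at this
        linarith
      _ = _ := by ring
  linarith

lemma cover_exists (S : Set ℝ) (s : ℝ) (hs : 0 < s)
    (h0 : MeasureTheory.Measure.hausdorffMeasure s S = 0) (r : ℝ) (hr : 0 < r) :
    ∃ c d : ℕ → ℝ, (∀ n, 0 < d n ∧ d n ≤ r) ∧ (∀ F : Finset ℕ, ∑ n ∈ F, d n ^ s ≤ 2) ∧
      ∀ β ∈ S, ∃ n, |β - c n| ≤ d n := by
  rw [MeasureTheory.Measure.hausdorffMeasure_apply] at h0
  have h1 : (⨅ (t : ℕ → Set ℝ) (_ : S ⊆ ⋃ n, t n) (_ : ∀ n, Metric.ediam (t n) ≤ ENNReal.ofReal r),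
          ∑' n, ⨆ _ : (t n).Nonempty, Metric.ediam (t n) ^ s) = 0 := by
    refine le_antisymm ?_ zero_le
    rw [← h0]
    exact le_iSup₂_of_le (ENNReal.ofReal r) (ENNReal.ofReal_pos.2 hr) le_rfl
  have h2 := lt_of_eq_of_lt h1 (one_pos : (0:ENNReal) < 1)
  simp only [iInf_lt_iff] at h2
  obtain ⟨t, hcov, hdiam, hsum⟩ := h2
  have hfin : ∀ n, Metric.ediam (t n) ≠ ⊤ := fun n => ne_top_of_le_ne_top ENNReal.ofReal_ne_top (hdiam n)
  let η : ℕ → ℝ := fun n => min r (((1:ℝ) / 2 ^ (n+1)) ^ (1 / s))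
  have hη0 : ∀ n, 0 < η n := fun n => lt_min hr (by positivity)
  have hηs : ∀ n, η n ^ s ≤ 1 / 2 ^ (n+1) := by
    intro n
    calc η n ^ s ≤ (((1:ℝ) / 2 ^ (n+1)) ^ (1 / s)) ^ s :=
          Real.rpow_le_rpow (hη0 n).le (min_le_right _ _) hs.le
      _ = _ := by rw [← Real.rpow_mul (by positivity), one_div_mul_cancel hs.ne', Real.rpow_one]
  have hex : ∀ n, ∃ c : ℝ, (t n).Nonempty → c ∈ t n := by
    intro n
    by_cases h : (t n).Nonempty
    · exact ⟨h.some, fun _ => h.some_mem⟩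
    · exact ⟨0, fun h' => absurd h' h⟩
  choose c hc using hex
  refine ⟨c, fun n => max (Metric.ediam (t n)).toReal (η n), ?_, ?_, ?_⟩
  · intro n
    refine ⟨lt_max_of_lt_right (hη0 n), max_le ?_ (min_le_left _ _)⟩
    exact ENNReal.toReal_le_of_le_ofReal hr.le (hdiam n)
  · intro F
    have a1 : ∀ n ∈ F, max (Metric.ediam (t n)).toReal (η n) ^ s ≤
        (Metric.ediam (t n) ^ s).toReal + 1 / 2 ^ (n+1) := by
      intro n _
      have b1 : 0 ≤ (Metric.ediam (t n) ^ s).toReal := ENNReal.toReal_nonneg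
      have b2 : (0:ℝ) ≤ 1 / 2 ^ (n+1) := by positivity
      rcases max_choice (Metric.ediam (t n)).toReal (η n) with h | h
      · rw [h, ENNReal.toReal_rpow]; linarith
      · rw [h]; linarith [hηs n]
    refine (Finset.sum_le_sum a1).trans ?_
    rw [Finset.sum_add_distrib]
    have a2 : ∑ n ∈ F, (Metric.ediam (t n) ^ s).toReal ≤ 1 := by
      rw [← ENNReal.toReal_sum (fun n _ => ENNReal.rpow_ne_top_of_nonneg hs.le (hfin n))]
      apply ENNReal.toReal_le_of_le_ofReal zero_le_one
      rw [ENNReal.ofReal_one]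
      refine le_trans ?_ hsum.le
      refine le_trans (Finset.sum_le_sum (fun n _ => ?_)) (ENNReal.sum_le_tsum F)
      rcases (t n).eq_empty_or_nonempty with h | h
      · rw [h]; simp [hs]
      · exact le_iSup_of_le h le_rfl
    have a3 : ∑ n ∈ F, (1:ℝ) / 2 ^ (n+1) ≤ 1 := by
      have hh := hasSum_geometric_two' 1
      have := sum_le_hasSum F (fun n _ => by positivity) hh
      refine le_trans (le_of_eq (Finset.sum_congr rfl fun n _ => ?_)) this
      rw [pow_succ]; field_simp
    linarith
  · intro β hβ
    obtain ⟨n, hn⟩ := Set.mem_iUnion.1 (hcov hβ)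
    refine ⟨n, le_trans ?_ (le_max_left _ _)⟩
    rw [← Real.dist_eq, dist_edist]
    exact ENNReal.toReal_mono (hfin n) (Metric.edist_le_ediam_of_mem hn (hc n ⟨β, hn⟩))

lemma vcount (c d : ℕ → ℝ) (s : ℝ) (hs1 : s < 1)
    (hsum : ∀ F : Finset ℕ, ∑ n ∈ F, d n ^ s ≤ 2) (W : ℝ) (hW : 0 < W) (ρ : ℝ) (hρ : 0 < ρ) (E : Finset ℤ)
    (hE : ∀ k ∈ E, ∃ n, 1 / W < d n ∧ d n ≤ ρ ∧ |(k:ℝ) / W - c n| ≤ d n + 1 / W) :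
    (E.card : ℝ) ≤ 10 * W * ρ ^ (1 - s) := by
  choose! f hf using hE
  have h1 := Finset.card_eq_sum_card_image f E
  have h2 : (E.card : ℝ) = ∑ p ∈ E.image f, ((E.filter (fun k => f k = p)).card : ℝ) := by
    exact_mod_cast h1
  have hfib : ∀ n ∈ E.image f, ((E.filter (fun k => f k = n)).card : ℝ) ≤ 5 * W * ρ ^ (1 - s) * d n ^ s := by
    intro n hn
    obtain ⟨k0, hk0, rfl⟩ := Finset.mem_image.1 hn
    obtain ⟨g1, g2, _⟩ := hf k0 hk0
    have hd0 : 0 < d (f k0) := lt_trans (by positivity) g1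
    have g3 : 1 < d (f k0) * W := by rwa [div_lt_iff₀ hW] at g1
    have h3 := card_int_le (c (f k0) * W - d (f k0) * W - 1) (c (f k0) * W + d (f k0) * W + 1) (by linarith)
      (E.filter (fun k => f k = f k0)) (by
        intro k hk
        rw [Finset.mem_filter] at hk
        have h4 := (hf k hk.1).2.2
        rw [hk.2] at h4
        have h5 : |(k:ℝ) - c (f k0) * W| ≤ d (f k0) * W + 1 := by
          have e : (k:ℝ) - c (f k0) * W = ((k:ℝ) / W - c (f k0)) * W := by field_simp
          have e2 : d (f k0) * W + 1 = (d (f k0) + 1 / W) * W := by field_simp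
          rw [e, abs_mul, abs_of_pos hW, e2]
          gcongr
        rw [abs_le] at h5
        constructor <;> linarith)
    have h6 : d (f k0) ≤ ρ ^ (1 - s) * d (f k0) ^ s := by
      calc d (f k0) = d (f k0) ^ (1 - s) * d (f k0) ^ s := by
            rw [← Real.rpow_add hd0, sub_add_cancel, Real.rpow_one]
        _ ≤ _ := by
          gcongr
    have h7 : 5 * W * d (f k0) ≤ 5 * W * (ρ ^ (1 - s) * d (f k0) ^ s) := by gcongr
    linarith
  rw [h2]
  refine (Finset.sum_le_sum hfib).trans ?_
  rw [← Finset.mul_sum]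
  calc _ ≤ 5 * W * ρ ^ (1 - s) * 2 := by
        gcongr
        exact hsum _
    _ = _ := by ring

noncomputable def uu (a α β : ℝ) (q : ℕ) : ℝ :=
  (q : ℝ) * (Real.log q) ^ (2 - a) * (Real.log (1 / nint (q * α))) ^ a * nint (q * α) * nint (q * β)

lemma hit_conseq (a : ℝ) (ha : 0 < a) (ha1 : a < 1) (α c : ℝ) (hc : 0 < c)
    (hα : ∀ q : ℕ, 1 ≤ q → c ≤ (q : ℝ) * nint (q * α)) :
    ∃ M3 : ℕ, ∀ M ≥ M3, ∀ k : ℤ, Hit α M k → ∀ β : ℝ, |β - k / 2 ^ (10 * M)| ≤ 1 / 2 ^ (10 * M) →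
      ∃ q : ℕ, M ≤ q ∧ uu a α β q ≤ 98 := by
  refine ⟨⌈1 / c⌉₊ + 1, ?_⟩
  rintro M hM k ⟨q, hq, p, hp⟩ β hβ
  have hM1 : (1:ℝ) ≤ M := by exact_mod_cast (by omega : 1 ≤ M)
  have hMc : 1 / c ≤ M := by
    refine (Nat.le_ceil _).trans ?_
    have h0 : ⌈1 / c⌉₊ ≤ M := by omega
    exact Nat.cast_le.2 h0
  set t : ℝ := 2 ^ M with ht
  have htM : (M:ℝ) ≤ t := by
    have := (Nat.lt_two_pow_self (n := M)).le
    rw [ht]; exact_mod_cast this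
  have ht1 : 1 ≤ t := hM1.trans htM
  have ht0 : 0 < t := by linarith
  have hct : 1 ≤ t * c := by
    have := hMc.trans htM
    rwa [div_le_iff₀ hc] at this
  have p5 : (2:ℝ) ^ (5 * M) = t ^ 5 := by rw [ht, ← pow_mul]; congr 1; ring
  have p6 : (2:ℝ) ^ (6 * M) = t ^ 6 := by rw [ht, ← pow_mul]; congr 1; ring
  have p10 : (2:ℝ) ^ (10 * M) = t ^ 10 := by rw [ht, ← pow_mul]; congr 1; ring
  rw [p10] at hp hβ
  obtain ⟨⟨h1, h2⟩, l, _, h3⟩ := (mem_QQ α M q).1 hq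
  have hq0 : (0:ℝ) < q := by exact_mod_cast h1
  have hY := hα q h1
  set Y := nint (q * α) with hYd
  have hYp : 0 < Y := by
    rcases (nint_nonneg (q * α)).lt_or_eq with h | h
    · exact h
    · rw [hYd, ← h] at hY; linarith
  have hYu : Y ≤ 1 / t ^ 5 := by
    rw [← p5]; exact (nint_le _ l).trans h3
  have hqu : (q:ℝ) ≤ t ^ 6 := by rw [← p6]; exact_mod_cast h2
  have hqt : t ≤ q := by
    have h4 : c ≤ q * (1 / t ^ 5) := hY.trans (by gcongr)
    rw [mul_one_div, le_div_iff₀ (by positivity)] at h4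
    refine le_trans ?_ h4
    have : (1:ℝ) ≤ t ^ 3 := one_le_pow₀ ht1
    have e : c * t ^ 5 = ((t * c) * t ^ 3) * t := by ring
    rw [e]
    have : 1 ≤ (t * c) * t ^ 3 := by nlinarith
    nlinarith
  refine ⟨q, by exact_mod_cast htM.trans hqt, ?_⟩
  have hl2 : Real.log 2 ≤ 1 := by linarith [Real.log_two_lt_d9]
  have hlt : Real.log t ≤ M := by
    rw [ht, Real.log_pow]
    nlinarith
  have hL0 : 0 ≤ Real.log q := Real.log_natCast_nonneg q
  have hL : Real.log q ≤ 7 * M := by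
    have := Real.log_le_log hq0 hqu
    rw [Real.log_pow] at this
    push_cast at this
    linarith
  have hl0 : 0 ≤ Real.log (1 / Y) := by
    apply Real.log_nonneg
    rw [le_div_iff₀ hYp]
    linarith [nint_le_half (q * α)]
  have hl : Real.log (1 / Y) ≤ 7 * M := by
    have h4 : 1 / Y ≤ t ^ 7 := by
      rw [div_le_iff₀ hYp]
      calc (1:ℝ) ≤ t * c := hct
        _ ≤ t * (t ^ 6 * Y) := by
          have : (q:ℝ) * Y ≤ t ^ 6 * Y := by gcongr
          have := hY.trans this
          gcongr
        _ = _ := by ring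
    have := Real.log_le_log (by positivity) h4
    rw [Real.log_pow] at this
    push_cast at this
    linarith
  have hLl : (Real.log q) ^ (2 - a) * (Real.log (1 / Y)) ^ a ≤ 49 * M ^ 2 := by
    calc _ ≤ (7 * (M:ℝ)) ^ (2 - a) * (7 * (M:ℝ)) ^ a := by
          apply mul_le_mul
          · exact Real.rpow_le_rpow hL0 hL (by linarith)
          · exact Real.rpow_le_rpow hl0 hl ha.le
          · exact Real.rpow_nonneg hl0 _
          · positivity
      _ = _ := by
        rw [← Real.rpow_add (by positivity), sub_add_cancel, Real.rpow_two]; ring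
  have hS : (M:ℝ) ^ 2 / 16 ≤ SQ α M := sum_QQ α c hc hα M
  have hS0 : 0 < SQ α M := lt_of_lt_of_le (by positivity) hS
  have hnb : nint (q * β) ≤ xq α M q + 1 / t ^ 4 := by
    refine (nint_le _ p).trans ?_
    have e : (q:ℝ) * β - p = ((q:ℝ) * (k / t ^ 10) - p) + q * (β - k / t ^ 10) := by ring
    rw [e]
    refine (abs_add_le _ _).trans ?_
    rw [abs_mul, abs_of_pos hq0]
    have : (q:ℝ) * |β - k / t ^ 10| ≤ t ^ 6 * (1 / t ^ 10) := by gcongr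
    have e2 : t ^ 6 * (1 / t ^ 10) = 1 / t ^ 4 := by field_simp
    linarith
  have hqx : q * Y * xq α M q ≤ 1 / M ^ 2 := by
    have e : q * Y * xq α M q = 1 / 288 / SQ α M := by
      rw [xq, ← hYd]; field_simp
    rw [e, div_le_iff₀ hS0, div_mul_eq_mul_div, le_div_iff₀ (by positivity)]
    linarith
  have hqt4 : q * Y * (1 / t ^ 4) ≤ 1 / M ^ 2 := by
    calc q * Y * (1 / t ^ 4) ≤ t ^ 6 * (1 / t ^ 5) * (1 / t ^ 4) := by gcongr
      _ = 1 / (t ^ 2 * t) := by field_simp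
      _ ≤ 1 / (M ^ 2 * 1) := by gcongr
      _ = _ := by rw [mul_one]
  have hprod : q * Y * nint (q * β) ≤ 2 / M ^ 2 := by
    calc _ ≤ q * Y * (xq α M q + 1 / t ^ 4) := by gcongr
      _ = q * Y * xq α M q + q * Y * (1 / t ^ 4) := by ring
      _ ≤ 1 / M ^ 2 + 1 / M ^ 2 := add_le_add hqx hqt4
      _ = _ := by ring
  have hn0 := nint_nonneg (q * β)
  calc uu a α β q = ((Real.log q) ^ (2 - a) * (Real.log (1 / Y)) ^ a) * (q * Y * nint (q * β)) := by
        rw [uu, ← hYd]; ring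
    _ ≤ (49 * M ^ 2) * (2 / M ^ 2) := by gcongr
    _ = 98 := by field_simp; norm_num

lemma danger_conseq (a : ℝ) (α c : ℝ) (hc : 0 < c)
    (hα : ∀ q : ℕ, 1 ≤ q → c ≤ (q : ℝ) * nint (q * α)) (m : ℕ) (hm : 1 ≤ m) (δ : ℝ) (k : ℤ)
    (hk : ¬ Danger a α m δ k) (β : ℝ) (hβ : |β - k / 2 ^ (100 * m)| ≤ 1 / 2 ^ (100 * m)) (q : ℕ)
    (hq : q ∈ Finset.Ico ((2:ℕ)^m) ((2:ℕ)^(10*m))) : δ ≤ uu a α β q := by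
  have h1 : δ * ww a α q + q / 2 ^ (100 * m) < |(q:ℝ) * (k / 2 ^ (100 * m)) - round (q * β)| := by
    by_contra h
    push Not at h
    exact hk ⟨q, hq, _, h⟩
  rw [Finset.mem_Ico] at hq
  have hq2 : 2 ≤ q := by
    refine le_trans ?_ hq.1
    calc 2 = 2 ^ 1 := by norm_num
      _ ≤ 2 ^ m := Nat.pow_le_pow_right (by norm_num) hm
  have hq0 : (0:ℝ) < q := by exact_mod_cast (by omega : 0 < q)
  have hq1 : (1:ℝ) < q := by exact_mod_cast (by omega : 1 < q)
  have hY := hα q (by omega)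
  have hYp : 0 < nint (q * α) := by
    rcases (nint_nonneg (q * α)).lt_or_eq with h | h
    · exact h
    · rw [← h] at hY; linarith
  have h2 : δ * ww a α q ≤ nint (q * β) := by
    have e : (q:ℝ) * (k / 2 ^ (100 * m)) - round (q * β) =
        (q * β - round (q * β)) - q * (β - k / 2 ^ (100 * m)) := by ring
    have h3 := abs_sub ((q:ℝ) * β - round (q * β)) (q * (β - k / 2 ^ (100 * m)))
    rw [← e, abs_mul, abs_of_pos hq0] at h3
    have h4 : (q:ℝ) * |β - k / 2 ^ (100 * m)| ≤ q * (1 / 2 ^ (100 * m)) := by gcongr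
    have e2 : (q:ℝ) * (1 / 2 ^ (100 * m)) = q / 2 ^ (100 * m) := by ring
    rw [nint]
    linarith
  have hL : 0 < (Real.log q) ^ (2 - a) := Real.rpow_pos_of_pos (Real.log_pos hq1) _
  have hl : 0 < (Real.log (1 / nint (q * α))) ^ a := by
    apply Real.rpow_pos_of_pos
    apply Real.log_pos
    rw [lt_div_iff₀ hYp]
    linarith [nint_le_half (q * α)]
  rw [ww] at h2
  rw [uu]
  rw [mul_one_div, div_le_iff₀ (by positivity)] at h2
  linarith

open Classical in
lemma cantor (N R : ℕ → ℕ) (hN0 : 1 ≤ N 0) (hR : ∀ t, 1 ≤ R t) (hN : ∀ t, N (t+1) = N t * R t)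
    (H A V : ℕ → ℤ → Prop) (κ ε : ℝ) (hκ : 0 < κ) (hε : ε ≤ κ ^ 2 / 8)
    (hH : ∀ (t : ℕ) (i : ℤ), κ * R t ≤ ((Finset.Ico (i * R t) ((i+1) * R t)).filter (H t)).card)
    (hA0 : ∀ i, ¬ A 0 i)
    (hA : ∀ (t : ℕ) (i : ℤ), (((Finset.Ico (i * (R t * R (t+1))) ((i+1) * (R t * R (t+1)))).filter
      (A (t+1))).card : ℝ) ≤ ε * (R t * R (t+1)))
    (hV : ∀ t, (((Finset.Ico (0:ℤ) (N (t+1))).filter (V t)).card : ℝ) ≤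
      κ / 4 * (κ / 2) ^ t * N (t+1)) :
    ∃ β : ℝ, ∀ t, ∃ i : ℤ, |β - i / N (t+1)| ≤ 1 / N (t+1) ∧ H t i ∧ ¬ A t i ∧ ¬ V t i := by
  let E : ℕ → Finset ℤ := fun t => Nat.rec (Finset.Ico 0 (N 0 : ℤ)) (fun t Et =>
    (Et.biUnion (fun i => Finset.Ico (i * R t) ((i+1) * R t))).filter
      (fun i => H t i ∧ ¬ A t i ∧ ¬ V t i)) t
  have hE0 : E 0 = Finset.Ico 0 (N 0 : ℤ) := rfl
  have hE : ∀ t, E (t+1) = ((E t).biUnion (fun i => Finset.Ico (i * R t) ((i+1) * R t))).filter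
      (fun i => H t i ∧ ¬ A t i ∧ ¬ V t i) := fun t => rfl
  clear_value E
  have hNpos : ∀ t, 0 < N t := by
    intro t
    induction t with
    | zero => exact hN0
    | succ t ih => rw [hN]; exact Nat.mul_pos ih (hR t)
  have hdisj : ∀ (r : ℕ) (s : Set ℤ), s.PairwiseDisjoint (fun i : ℤ => Finset.Ico (i * (r:ℤ)) ((i+1) * r)) := by
    intro r s i _ j _ hij
    rw [Function.onFun, Finset.disjoint_left]
    intro x hx hx'
    rw [Finset.mem_Ico] at hx hx'
    apply hij
    have h1 : i < j + 1 := by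
      by_contra h; push Not at h
      have := mul_le_mul_of_nonneg_right h (Int.natCast_nonneg r)
      omega
    have h2 : j < i + 1 := by
      by_contra h; push Not at h
      have := mul_le_mul_of_nonneg_right h (Int.natCast_nonneg r)
      omega
    omega
  have hrange : ∀ t, ∀ i ∈ E t, 0 ≤ i ∧ i < N t := by
    intro t
    induction t with
    | zero => intro i hi; rw [hE0, Finset.mem_Ico] at hi; exact hi
    | succ t ih =>
      intro i hi
      rw [hE, Finset.mem_filter, Finset.mem_biUnion] at hi
      obtain ⟨⟨j, hj, hij⟩, _⟩ := hi
      rw [Finset.mem_Ico] at hij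
      obtain ⟨h1, h2⟩ := ih j hj
      constructor
      · exact le_trans (by positivity) hij.1
      · rw [hN]; push_cast
        have : (j+1) * (R t:ℤ) ≤ N t * R t := by
          apply mul_le_mul_of_nonneg_right (by omega) (by positivity)
        omega
  have hbi : ∀ (r : ℕ) (s : Finset ℤ) (P : ℤ → Prop), (((s.biUnion (fun i : ℤ => Finset.Ico (i * (r:ℤ)) ((i+1) * r))).filter P).card : ℝ)
      = ∑ i ∈ s, (((Finset.Ico (i * (r:ℤ)) ((i+1) * r)).filter P).card : ℝ) := by
    intro r s P
    rw [Finset.filter_biUnion, Finset.card_biUnion]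
    · push_cast; rfl
    · intro i hi j hj hij
      exact Finset.disjoint_filter_filter (hdisj r Set.univ (Set.mem_univ i) (Set.mem_univ j) hij)
  -- general step
  have hstep : ∀ t, κ * R t * (E t).card - (((Finset.Ico (0:ℤ) (N (t+1))).filter (V t)).card : ℝ)
      - ((((E t).biUnion (fun i => Finset.Ico (i * R t) ((i+1) * R t))).filter (A t)).card : ℝ) ≤ (E (t+1)).card := by
    intro t
    have hsub : ((E t).biUnion (fun i => Finset.Ico (i * R t) ((i+1) * R t))).filter (H t) ⊆
      E (t+1) ∪ (((Finset.Ico (0:ℤ) (N (t+1))).filter (V t)) ∪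
        (((E t).biUnion (fun i => Finset.Ico (i * R t) ((i+1) * R t))).filter (A t))) := by
      intro i hi
      rw [Finset.mem_filter] at hi
      simp only [Finset.mem_union]
      by_cases hAi : A t i
      · right; right; rw [Finset.mem_filter]; exact ⟨hi.1, hAi⟩
      by_cases hVi : V t i
      · right; left; rw [Finset.mem_filter, Finset.mem_Ico]
        refine ⟨?_, hVi⟩
        obtain ⟨j, hj, hij⟩ := Finset.mem_biUnion.1 hi.1
        rw [Finset.mem_Ico] at hij
        obtain ⟨h1, h2⟩ := hrange t j hj
        constructor
        · exact le_trans (by positivity) hij.1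
        · rw [hN]; push_cast
          have : (j+1) * (R t:ℤ) ≤ N t * R t := by
            apply mul_le_mul_of_nonneg_right (by omega) (by positivity)
          omega
      left; rw [hE, Finset.mem_filter]; exact ⟨hi.1, hi.2, hAi, hVi⟩
    have h1 := (Finset.card_le_card hsub).trans (Finset.card_union_le _ _)
    have h2 := h1.trans (Nat.add_le_add_left (Finset.card_union_le _ _) _)
    have h3 : ((((E t).biUnion (fun i => Finset.Ico (i * R t) ((i+1) * R t))).filter (H t)).card : ℝ) ≤
      (E (t+1)).card + ((((Finset.Ico (0:ℤ) (N (t+1))).filter (V t)).card : ℝ) +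
        ((((E t).biUnion (fun i => Finset.Ico (i * R t) ((i+1) * R t))).filter (A t)).card : ℝ)) := by
      exact_mod_cast h2
    rw [hbi] at h3
    have h4 : κ * R t * (E t).card ≤ ∑ i ∈ E t, (((Finset.Ico (i * (R t:ℤ)) ((i+1) * R t)).filter (H t)).card : ℝ) := by
      rw [mul_comm, ← nsmul_eq_mul]
      apply Finset.card_nsmul_le_sum
      intro i _; exact hH t i
    linarith
  have hgrow : ∀ t, (κ / 2) ^ t * N t ≤ (E t).card ∧ κ / 2 * R t * (E t).card ≤ (E (t+1)).card := by
    intro t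
    induction t with
    | zero =>
      have h0 : ((E 0).card : ℝ) = N 0 := by rw [hE0]; simp
      refine ⟨by rw [h0]; simp, ?_⟩
      have h1 := hstep 0
      have h2 : (((E 0).biUnion (fun i => Finset.Ico (i * R 0) ((i+1) * R 0))).filter (A 0)) = ∅ := by
        apply Finset.filter_false_of_mem; intro i _; exact hA0 i
      rw [h2] at h1
      have h3 := hV 0
      rw [hN] at h3 h1
      push_cast at h3 h1
      rw [h0] at h1 ⊢
      simp only [pow_zero, Finset.card_empty, Nat.cast_zero] at h1 h3
      have : 0 ≤ κ * R 0 * N 0 := by positivity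
      linarith
    | succ t ih =>
      obtain ⟨ih1, ih2⟩ := ih
      have hc1 : (κ / 2) ^ (t+1) * N (t+1) ≤ (E (t+1)).card := by
        refine le_trans ?_ ih2
        rw [hN]; push_cast
        calc (κ / 2) ^ (t+1) * (N t * R t) = κ / 2 * R t * ((κ / 2) ^ t * N t) := by ring
          _ ≤ _ := by gcongr
      refine ⟨hc1, ?_⟩
      have h1 := hstep (t+1)
      have h3 := hV (t+1)
      -- bound on A
      have h4 : ((((E (t+1)).biUnion (fun i => Finset.Ico (i * R (t+1)) ((i+1) * R (t+1)))).filter (A (t+1))).card : ℝ)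
          ≤ ε * (R t * R (t+1)) * (E t).card := by
        have hsub : ((E (t+1)).biUnion (fun i => Finset.Ico (i * R (t+1)) ((i+1) * R (t+1)))).filter (A (t+1)) ⊆
          ((E t).biUnion (fun i => Finset.Ico (i * ((R t * R (t+1) : ℕ):ℤ)) ((i+1) * ((R t * R (t+1) : ℕ):ℤ)))).filter (A (t+1)) := by
          apply Finset.filter_subset_filter
          intro x hx
          obtain ⟨j, hj, hxj⟩ := Finset.mem_biUnion.1 hx
          rw [hE, Finset.mem_filter] at hj
          obtain ⟨i, hi, hji⟩ := Finset.mem_biUnion.1 hj.1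
          rw [Finset.mem_Ico] at hxj hji
          refine Finset.mem_biUnion.2 ⟨i, hi, ?_⟩
          rw [Finset.mem_Ico]
          push_cast
          have hR' : (0:ℤ) ≤ R (t+1) := by positivity
          constructor
          · have := mul_le_mul_of_nonneg_right hji.1 hR'
            linarith
          · have := mul_le_mul_of_nonneg_right (Int.add_one_le_iff.2 hji.2) hR'
            linarith
        have h5 : ((((E (t+1)).biUnion (fun i => Finset.Ico (i * R (t+1)) ((i+1) * R (t+1)))).filter (A (t+1))).card : ℝ) ≤
          ((((E t).biUnion (fun i => Finset.Ico (i * ((R t * R (t+1) : ℕ):ℤ)) ((i+1) * ((R t * R (t+1) : ℕ):ℤ)))).filter (A (t+1))).card : ℝ) := by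
          exact_mod_cast Finset.card_le_card hsub
        refine h5.trans ?_
        rw [hbi]
        rw [mul_comm (ε * _), ← nsmul_eq_mul]
        apply Finset.sum_le_card_nsmul
        intro i _
        have := hA t i
        push_cast
        exact this
      have h6 : ε * (R t * R (t+1)) * (E t).card ≤ κ / 4 * R (t+1) * (E (t+1)).card := by
        calc ε * (R t * R (t+1)) * (E t).card ≤ κ^2/8 * (R t * R (t+1)) * (E t).card := by gcongr
          _ = κ / 4 * R (t+1) * (κ / 2 * R t * (E t).card) := by ring
          _ ≤ _ := by gcongr
      have h7 : κ / 4 * (κ / 2) ^ (t+1) * N (t+1+1) ≤ κ / 4 * R (t+1) * (E (t+1)).card := by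
        rw [hN (t+1)]; push_cast
        calc κ / 4 * (κ / 2) ^ (t+1) * (N (t+1) * R (t+1)) = κ / 4 * R (t+1) * ((κ / 2) ^ (t+1) * N (t+1)) := by ring
          _ ≤ _ := by gcongr
      linarith
  have hne : ∀ t, (E t).Nonempty := by
    intro t
    rw [← Finset.card_pos]
    have h1 := (hgrow t).1
    have h2 : 0 < (κ / 2) ^ t * N t := by
      have := hNpos t
      positivity
    exact_mod_cast h2.trans_le h1
  let F : ℕ → Set ℝ := fun t => ⋃ i ∈ E t, Set.Icc ((i:ℝ) / N t) ((i+1) / N t)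
  have hFc : ∀ t, IsCompact (F t) := fun t => (E t).isCompact_biUnion (fun i _ => isCompact_Icc)
  have hFsub : ∀ t, F (t+1) ⊆ F t := by
    intro t x hx
    obtain ⟨j, hj, hxj⟩ := Set.mem_iUnion₂.1 hx
    rw [hE, Finset.mem_filter] at hj
    obtain ⟨i, hi, hji⟩ := Finset.mem_biUnion.1 hj.1
    refine Set.mem_iUnion₂.2 ⟨i, hi, ?_⟩
    rw [Finset.mem_Ico] at hji
    have hn : (0:ℝ) < N t := by exact_mod_cast hNpos t
    have hr : (0:ℝ) < R t := by exact_mod_cast hR t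
    have h1 : (i:ℝ) * R t ≤ j := by exact_mod_cast hji.1
    have h2 : (j:ℝ) + 1 ≤ (i + 1) * R t := by exact_mod_cast Int.add_one_le_iff.2 hji.2
    rw [hN] at hxj
    push_cast at hxj
    constructor
    · refine le_trans ?_ hxj.1
      rw [div_le_div_iff₀ hn (by positivity)]
      nlinarith
    · refine le_trans hxj.2 ?_
      rw [div_le_div_iff₀ (by positivity) hn]
      nlinarith
  have hFne : ∀ t, (F t).Nonempty := by
    intro t
    obtain ⟨i, hi⟩ := hne t
    refine ⟨(i:ℝ) / N t, Set.mem_iUnion₂.2 ⟨i, hi, ?_⟩⟩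
    refine ⟨le_rfl, ?_⟩
    gcongr; linarith
  obtain ⟨β, hβ⟩ := IsCompact.nonempty_iInter_of_sequence_nonempty_isCompact_isClosed F hFsub hFne
    (hFc 0) (fun t => (hFc t).isClosed)
  refine ⟨β, fun t => ?_⟩
  obtain ⟨i, hi, hβi⟩ := Set.mem_iUnion₂.1 (Set.mem_iInter.1 hβ (t+1))
  refine ⟨i, ?_, ?_⟩
  · rw [add_div] at hβi
    rw [abs_le]; constructor
    · have : (0:ℝ) ≤ 1 / N (t+1) := by positivity
      linarith [hβi.1]
    · linarith [hβi.2]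
  · rw [hE, Finset.mem_filter] at hi
    exact hi.2

lemma final_num (s : ℝ) (hs1 : s < 1) (M0 m t : ℕ) (hM0 : 16 / (1 - s) ≤ M0) (hm : M0 * (t + 1) ≤ m) :
    10 * (1 / (2:ℝ) ^ m) ^ (1 - s) ≤ (1 / 1152 : ℝ) / 4 * ((1 / 1152 : ℝ) / 2) ^ t := by
  have hσ : 0 < 1 - s := by linarith
  have h1 : 16 * ((t:ℝ) + 1) ≤ m * (1 - s) := by
    rw [div_le_iff₀ hσ] at hM0
    have h2 : (M0:ℝ) * (t + 1) ≤ m := by exact_mod_cast hm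
    have ht : (0:ℝ) ≤ t := Nat.cast_nonneg t
    nlinarith
  have h3 : (1 / (2:ℝ) ^ m) ^ (1 - s) ≤ 1 / 65536 ^ (t + 1) := by
    rw [Real.div_rpow (by norm_num) (by positivity), Real.one_rpow]
    apply one_div_le_one_div_of_le (by positivity)
    rw [← Real.rpow_natCast 2 m, ← Real.rpow_mul (by norm_num)]
    calc (65536:ℝ) ^ (t + 1) = (2:ℝ) ^ (16 * ((t:ℝ) + 1)) := by
          have e : (16 * ((t:ℝ) + 1)) = ((16 * (t + 1) : ℕ) : ℝ) := by push_cast; ring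
          rw [e, Real.rpow_natCast, pow_mul]; norm_num
      _ ≤ _ := Real.rpow_le_rpow_of_exponent_le (by norm_num) h1
  have h4 : (1 / (65536:ℝ)) ^ t ≤ ((1 / 1152 : ℝ) / 2) ^ t :=
    pow_le_pow_left₀ (by norm_num) (by norm_num) t
  have h5 : (1:ℝ) / 65536 ^ (t + 1) = 1 / 65536 * (1 / 65536) ^ t := by
    rw [← one_div_pow, pow_succ]; ring
  have h6 : (0:ℝ) ≤ (1 / 65536) ^ t := by positivity
  rw [h5] at h3
  nlinarith

lemma find_level (P : ℕ → Prop) (h0 : ¬ P 0) (h : ∃ t, P t) : ∃ t, ¬ P t ∧ P (t + 1) := by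
  by_contra hc
  push Not at hc
  obtain ⟨t, ht⟩ := h
  have : ∀ t, ¬ P t := by
    intro t
    induction t with
    | zero => exact h0
    | succ n ih => exact hc n ih
  exact this t ht

theorem stmt_8 (a : ℝ) (ha : 0 < a) (ha1 : a < 1) (α : ℝ)
    (hα : ∃ δ > 0, ∀ q : ℕ, 1 ≤ q → δ ≤ (q : ℝ) * nint (q * α)) :
    dimH {β : ℝ |
      0 < atTop.liminf (fun q : ℕ =>
        (q : ℝ) * (Real.log q) ^ (2 - a) * (Real.log (1 / nint (q * α))) ^ a
          * nint (q * α) * nint (q * β))} = 1 := by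
  classical
  obtain ⟨c, hc, hα⟩ := hα
  set S : Set ℝ := {β : ℝ |
      0 < atTop.liminf (fun q : ℕ =>
        (q : ℝ) * (Real.log q) ^ (2 - a) * (Real.log (1 / nint (q * α))) ^ a
          * nint (q * α) * nint (q * β))} with hS
  refine le_antisymm ((dimH_mono (Set.subset_univ S)).trans Real.dimH_univ.le) ?_
  by_contra hlt
  rw [not_le] at hlt
  obtain ⟨s, hs, hs1⟩ := ENNReal.lt_iff_exists_nnreal_btwn.1 hlt
  have hs0 : (0:ℝ) < s := by
    have : (0:ENNReal) < s := lt_of_le_of_lt zero_le hs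
    exact_mod_cast this
  have hs1' : (s:ℝ) < 1 := by exact_mod_cast hs1
  have hmeas := hausdorffMeasure_of_dimH_lt hs
  obtain ⟨M1, hM1⟩ := hit_lower α c hc hα
  obtain ⟨δ, hδ, M2, hM2⟩ := danger_upper a ha ha1 α c hc hα ((1 / 1152 : ℝ) ^ 2 / 8) (by norm_num)
  obtain ⟨M3, hM3⟩ := hit_conseq a ha ha1 α c hc hα
  obtain ⟨M0, hM0⟩ : ∃ M0 : ℕ, M0 = M1 + M2 + M3 + ⌈16 / (1 - (s:ℝ))⌉₊ + 1 := ⟨_, rfl⟩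
  have hM0s : 16 / (1 - (s:ℝ)) ≤ M0 := by
    refine (Nat.le_ceil _).trans ?_
    exact_mod_cast (by omega : ⌈16 / (1 - (s:ℝ))⌉₊ ≤ M0)
  obtain ⟨m, hm⟩ : ∃ m : ℕ → ℕ, m = fun t => M0 * 10 ^ t := ⟨_, rfl⟩
  have hm0 : m 0 = M0 := by simp [hm]
  have hms : ∀ t, m (t + 1) = 10 * m t := by intro t; simp only [hm]; ring
  have hmt : ∀ t, M0 * (t + 1) ≤ m t := by
    intro t
    induction t with
    | zero => rw [hm0]; omega
    | succ n ih => rw [hms]; nlinarith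
  clear hm
  have hmM : ∀ t, M0 ≤ m t := fun t => le_trans (Nat.le_mul_of_pos_right _ (by omega)) (hmt t)
  have hmlt : ∀ t, t < m t := fun t => lt_of_lt_of_le (Nat.lt_succ_self t)
    (le_trans (Nat.le_mul_of_pos_left _ (by omega)) (hmt t))
  obtain ⟨C, d, hd, hdsum, hcov⟩ := cover_exists S s hs0 hmeas (1 / 2 ^ M0) (by positivity)
  obtain ⟨V, hVdef⟩ : ∃ V : ℕ → ℤ → Prop, V = fun (t : ℕ) (k : ℤ) => ∃ n, 1 / (2:ℝ) ^ m (t+1) < d n ∧ d n ≤ 1 / 2 ^ m t ∧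
      |(k:ℝ) / 2 ^ m (t+1) - C n| ≤ d n + 1 / 2 ^ m (t+1) := ⟨_, rfl⟩
  obtain ⟨A, hA0, hAs⟩ : ∃ A : ℕ → ℤ → Prop, (∀ i, ¬ A 0 i) ∧ ∀ t, A (t+1) = Danger a α (m t) δ :=
    ⟨fun t => Nat.casesOn t (fun _ => False) (fun t => Danger a α (m t) δ), fun _ h => h, fun _ => rfl⟩
  obtain ⟨β, hβ⟩ := cantor (fun t => 2 ^ m t) (fun t => 2 ^ (9 * m t)) Nat.one_le_two_pow
    (fun t => Nat.one_le_two_pow)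
    (by intro t; show 2 ^ m (t+1) = 2 ^ m t * 2 ^ (9 * m t); rw [← pow_add, hms]; congr 1; omega)
    (fun t => Hit α (m t)) A V (1 / 1152) ((1 / 1152 : ℝ) ^ 2 / 8) (by norm_num) le_rfl
    (by
      intro t i
      have := hM1 (m t) (by have := hmM t; omega) i
      convert this using 3)
    hA0
    (by
      intro t i
      have h := hM2 (m t) (by have := hmM t; omega) i
      have e : (2:ℕ) ^ (99 * m t) = 2 ^ (9 * m t) * 2 ^ (9 * m (t+1)) := by
        rw [← pow_add, hms]; congr 1; omega
      rw [e, Nat.cast_mul, Nat.cast_mul] at h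
      rw [hAs]
      convert h using 3)
    (by
      intro t
      have h := vcount C d s hs1' hdsum ((2:ℝ) ^ m (t+1)) (by positivity) (1 / 2 ^ m t) (by positivity)
        ((Finset.Ico (0:ℤ) ((2 ^ m (t+1) : ℕ) : ℤ)).filter (V t)) (by
          intro k hk
          have h2 := (Finset.mem_filter.1 hk).2
          rw [hVdef] at h2
          exact h2)
      have h2 := final_num s hs1' M0 (m t) t hM0s (hmt t)
      have h3 : (0:ℝ) < 2 ^ m (t+1) := by positivity
      have h4 := mul_le_mul_of_nonneg_right h2 h3.le
      have e : (((2 ^ m (t+1) : ℕ)) : ℝ) = 2 ^ m (t+1) := by push_cast; rfl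
      have h5 : (((Finset.Ico (0:ℤ) ((2 ^ m (t+1) : ℕ) : ℤ)).filter (V t)).card : ℝ) ≤
          (1 / 1152 : ℝ) / 4 * ((1 / 1152 : ℝ) / 2) ^ t * ((2 ^ m (t+1) : ℕ) : ℝ) := by
        rw [e]; linarith
      convert h5 using 3)
  have hβ' : ∀ t, ∃ i : ℤ, |β - i / 2 ^ m (t+1)| ≤ 1 / 2 ^ m (t+1) ∧ Hit α (m t) i ∧ ¬ A t i ∧ ¬ V t i := by
    intro t
    obtain ⟨i, h1, h2, h3, h4⟩ := hβ t
    refine ⟨i, ?_, h2, h3, h4⟩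
    push_cast at h1
    exact h1
  clear hβ
  have hlow : ∀ᶠ q : ℕ in atTop, δ ≤ uu a α β q := by
    filter_upwards [eventually_ge_atTop (2 ^ M0)] with q hq
    obtain ⟨t, ht1, ht2⟩ := find_level (fun t => q < 2 ^ m t) (by rw [hm0]; omega)
      ⟨q, (hmlt q).trans Nat.lt_two_pow_self⟩
    obtain ⟨i, h1, -, h3, -⟩ := hβ' (t+1)
    rw [hAs] at h3
    have e : m (t + 1 + 1) = 100 * m t := by rw [hms, hms]; ring
    rw [e] at h1
    refine danger_conseq a α c hc hα (m t) (by have := hmM t; omega) δ i h3 β h1 q ?_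
    rw [Finset.mem_Ico, ← hms]
    exact ⟨not_lt.1 ht1, ht2⟩
  have hfreq : ∃ᶠ q : ℕ in atTop, uu a α β q ≤ 98 := by
    rw [frequently_atTop]
    intro t
    obtain ⟨i, h1, h2, -, -⟩ := hβ' t
    rw [hms] at h1
    obtain ⟨q, hq, hu⟩ := hM3 (m t) (by have := hmM t; omega) i h2 β h1
    exact ⟨q, (hmlt t).le.trans hq, hu⟩
  have hβS : β ∈ S := by
    have h := le_liminf_of_le (IsCoboundedUnder.of_frequently_le hfreq) hlow
    exact lt_of_lt_of_le hδ h
  obtain ⟨n, hn⟩ := hcov β hβS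
  obtain ⟨t, ht1, ht2⟩ := find_level (fun t => 1 / (2:ℝ) ^ m t < d n)
    (by rw [hm0]; exact not_lt.2 (hd n).2)
    (by
      obtain ⟨k, hk⟩ := exists_pow_lt_of_lt_one (hd n).1 (by norm_num : (1/2 : ℝ) < 1)
      refine ⟨k, lt_of_le_of_lt ?_ hk⟩
      rw [← one_div_pow]
      exact pow_le_pow_of_le_one (by norm_num) (by norm_num) (hmlt k).le)
  obtain ⟨i, h1, -, -, h4⟩ := hβ' t
  apply h4
  rw [hVdef]
  refine ⟨n, ht2, not_lt.1 ht1, ?_⟩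
  rw [abs_sub_comm] at h1
  have := abs_sub_le ((i:ℝ) / 2 ^ m (t+1)) β (C n)
  linarith
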